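/- arXiv:2101.00668 — 8 statements merged into one kernel-verified Lean document; each statement's English description precedes it below -/
import Mathlib

section
/- Let p be a prime, R' a perfect 𝔽_p-algebra, a ∈ R', and u a unit of the ring of p-typical Witt vectors W(R'); set R := W(R')/([a] + p·u), where [a] is the Teichmüller lift of a. Then there exists an element ω ∈ R such that ω^p divides p in R, and for every element ω ∈ R with ω^p dividing p, the ring homomorphism R/(ω) → R/(ω^p) induced by x ↦ x^p is bijective. -/
/-- The `p`-th power map as a ring homomorphism `A/(ω) → A/(ω ^ p)`, for `ω ^ p ∣ p`. -/
noncomputable def quotientPowHom {p : ℕ} (hp : p.Prime) {A : Type*} [CommRing A] {ω : A}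
    (hω : ω ^ p ∣ (p : A)) : (A ⧸ Ideal.span {ω}) →+* A ⧸ Ideal.span {ω ^ p} :=
  Ideal.Quotient.lift (Ideal.span {ω})
    { toFun := fun x => Ideal.Quotient.mk (Ideal.span {ω ^ p}) (x ^ p)
      map_one' := by simp
      map_zero' := by simp [hp.ne_zero]
      map_mul' := fun x y => by rw [mul_pow, map_mul]
      map_add' := fun x y => by
        obtain ⟨r, hr⟩ := exists_add_pow_prime_eq hp x y
        rw [← map_add, Ideal.Quotient.mk_eq_mk_iff_sub_mem, Ideal.mem_span_singleton, hr,
          add_sub_cancel_left, mul_assoc, mul_assoc]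
        exact hω.mul_right _ }
    (fun x hx => by
      rw [Ideal.mem_span_singleton] at hx
      exact Ideal.Quotient.eq_zero_iff_mem.mpr
        (Ideal.mem_span_singleton.mpr (pow_dvd_pow_of_dvd hx p)))

theorem quotientPowHom_mk {p : ℕ} (hp : p.Prime) {A : Type*} [CommRing A] {ω : A}
    (hω : ω ^ p ∣ (p : A)) (x : A) :
    quotientPowHom hp hω (Ideal.Quotient.mk (Ideal.span {ω}) x) =
      Ideal.Quotient.mk (Ideal.span {ω ^ p}) (x ^ p) :=
  rfl

theorem quotientPowHom_injective {p : ℕ} (hp : p.Prime) {A : Type*} [CommRing A] {ω : A}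
    (hω : ω ^ p ∣ (p : A)) (h : ∀ x : A, ω ^ p ∣ x ^ p → ω ∣ x) :
    Function.Injective (quotientPowHom hp hω) := by
  rw [injective_iff_map_eq_zero]
  intro x hx
  obtain ⟨x, rfl⟩ := Ideal.Quotient.mk_surjective x
  rw [quotientPowHom_mk, Ideal.Quotient.eq_zero_iff_mem, Ideal.mem_span_singleton] at hx
  exact Ideal.Quotient.eq_zero_iff_mem.mpr (Ideal.mem_span_singleton.mpr (h x hx))

theorem quotientPowHom_surjective {p : ℕ} (hp : p.Prime) {A : Type*} [CommRing A] {ω : A}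
    (hω : ω ^ p ∣ (p : A)) (h : ∀ x : A, ∃ y : A, (p : A) ∣ y ^ p - x) :
    Function.Surjective (quotientPowHom hp hω) := by
  intro x
  obtain ⟨x, rfl⟩ := Ideal.Quotient.mk_surjective x
  obtain ⟨y, hy⟩ := h x
  refine ⟨Ideal.Quotient.mk _ y, ?_⟩
  rw [quotientPowHom_mk, Ideal.Quotient.mk_eq_mk_iff_sub_mem, Ideal.mem_span_singleton]
  exact hω.trans hy

namespace WittVector

theorem exists_pow_dvd_p {p : ℕ} [Fact p.Prime] {k : Type*} [CommRing k] [PerfectRing k p]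
    {A : Type*} [CommRing A] {q : WittVector p k →+* A} {a : k} {u : (WittVector p k)ˣ}
    (hq : q (teichmuller p a + p * u) = 0) : ∃ ω : A, ω ^ p ∣ (p : A) := by
  obtain ⟨c, rfl⟩ := (PerfectRing.bijective_frobenius (R := k) (p := p)).surjective a
  refine ⟨q (teichmuller p c), -q ↑u⁻¹, ?_⟩
  have h : q u * q ↑u⁻¹ = 1 := by rw [← map_mul, Units.mul_inv, map_one]
  simp only [map_add, map_mul, map_natCast, map_pow] at hq
  linear_combination q ↑u⁻¹ * hq - p * h

variable {p : ℕ} [Fact p.Prime] {k : Type*} [CommRing k] [CharP k p] [PerfectRing k p]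

theorem p_dvd_iff_coeff_zero_eq_zero (x : WittVector p k) :
    (p : WittVector p k) ∣ x ↔ x.coeff 0 = 0 := by
  rw [← mem_span_p_iff_coeff_zero_eq_zero, Ideal.mem_span_singleton]

theorem exists_eq_teichmuller_add_p_mul (x : WittVector p k) :
    ∃ y : WittVector p k, x = teichmuller p (x.coeff 0) + p * y := by
  have h : (p : WittVector p k) ∣ x - teichmuller p (x.coeff 0) := by
    rw [p_dvd_iff_coeff_zero_eq_zero]
    change constantCoeff (x - teichmuller p (x.coeff 0)) = 0
    rw [map_sub, sub_eq_zero]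
    exact (teichmuller_coeff_zero p _).symm
  obtain ⟨y, hy⟩ := h
  exact ⟨y, by rw [← hy]; ring⟩

theorem p_mul_cancel {x y : WittVector p k}
    (h : (p : WittVector p k) * x = p * y) : x = y := by
  rw [← sub_eq_zero]
  apply eq_zero_of_p_mul_eq_zero
  linear_combination h

theorem exists_teichmuller_add_teichmuller_neg (m : k) :
    ∃ g : WittVector p k,
      teichmuller p m + teichmuller p (-m) = p * (g * teichmuller p m) := by
  have h : (p : WittVector p k) ∣ teichmuller p (1 : k) + teichmuller p (-1 : k) := by
    rw [p_dvd_iff_coeff_zero_eq_zero]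
    change constantCoeff (teichmuller p (1 : k) + teichmuller p (-1 : k)) = 0
    rw [map_add]
    change (teichmuller p (1 : k)).coeff 0 + (teichmuller p (-1 : k)).coeff 0 = 0
    rw [teichmuller_coeff_zero, teichmuller_coeff_zero, add_neg_cancel]
  obtain ⟨g, hg⟩ := h
  refine ⟨g, ?_⟩
  rw [← mul_assoc, ← hg, add_mul, ← map_mul, ← map_mul, one_mul, neg_one_mul]

theorem exists_mul_one_sub_eq_of_p_sub_eq {a β : k} {u c e : WittVector p k}
    (h : (p : WittVector p k) - teichmuller p β * c = (teichmuller p a + p * u) * e) :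
    ∃ r s : k, a * (1 - a * r) = β * s := by
  obtain ⟨c', hc⟩ := exists_eq_teichmuller_add_p_mul c
  obtain ⟨e', he⟩ := exists_eq_teichmuller_add_p_mul e
  set c₀ := c.coeff 0
  set e₀ := e.coeff 0
  have hcoeff : ∀ x : k, constantCoeff (teichmuller p x) = x := teichmuller_coeff_zero p
  have hp0 : constantCoeff (p : WittVector p k) = 0 := by simp
  have h0 : -(β * c₀) = a * e₀ := by
    have := congrArg constantCoeff h
    simp only [map_sub, map_mul, map_add, hcoeff, hp0, zero_sub, zero_mul, add_zero] at this
    exact this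
  obtain ⟨g, hg⟩ := exists_teichmuller_add_teichmuller_neg (p := p) (a * e₀)
  have h1 : β * c₀ = -(a * e₀) := by rw [← h0, neg_neg]
  rw [← h1, map_mul, map_mul] at hg
  have key : 1 - u * e - teichmuller p β * c' - teichmuller p a * e' =
      g * (teichmuller p a * teichmuller p e₀) := by
    apply p_mul_cancel
    linear_combination h + hg + teichmuller p β * hc + teichmuller p a * he
  have h2 := congrArg constantCoeff key
  simp only [map_sub, map_mul, map_one, hcoeff] at h2
  have h3 : constantCoeff e = e₀ := rfl
  rw [h3] at h2
  refine ⟨constantCoeff e', a * constantCoeff c' - c₀ * (constantCoeff u + constantCoeff g * a), ?_⟩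
  linear_combination a * h2 - (constantCoeff u + constantCoeff g * a) * h0

theorem p_mem_jacobson_bot : (p : WittVector p k) ∈ (⊥ : Ideal (WittVector p k)).jacobson :=
  IsAdicComplete.le_jacobson_bot (Ideal.span {(p : WittVector p k)})
    (Ideal.mem_span_singleton_self _)

section Quotient

variable {A : Type*} [CommRing A] {q : WittVector p k →+* A}

theorem mem_jacobson_bot_of_p_dvd (hq : Function.Surjective q) {x : A} (hx : (p : A) ∣ x) :
    x ∈ (⊥ : Ideal A).jacobson := by
  obtain ⟨y, rfl⟩ := hx
  apply Ideal.mul_mem_right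
  rw [Ideal.mem_jacobson_bot]
  intro z
  obtain ⟨z, rfl⟩ := hq z
  simpa using (Ideal.mem_jacobson_bot.mp (p_mem_jacobson_bot (p := p) (k := k)) z).map q

theorem exists_eq_map_teichmuller_add_p_mul (hq : Function.Surjective q) (x : A) :
    ∃ (b : k) (r : A), x = q (teichmuller p b) + p * r := by
  obtain ⟨w, rfl⟩ := hq x
  obtain ⟨y, hy⟩ := exists_eq_teichmuller_add_p_mul w
  refine ⟨w.coeff 0, q y, ?_⟩
  conv_lhs => rw [hy]
  simp

theorem exists_p_dvd_pow_sub (hq : Function.Surjective q) (x : A) :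
    ∃ y : A, (p : A) ∣ y ^ p - x := by
  obtain ⟨b, r, rfl⟩ := exists_eq_map_teichmuller_add_p_mul hq x
  obtain ⟨c, rfl⟩ := (PerfectRing.bijective_frobenius (R := k) (p := p)).surjective b
  refine ⟨q (teichmuller p c), -r, ?_⟩
  simp only [map_pow]
  ring

theorem exists_associated_map_teichmuller (hq : Function.Surjective q) {ω : A}
    (hω : ω ^ p ∣ (p : A)) : ∃ b : k, Associated (q (teichmuller p b)) ω := by
  have hp : p.Prime := Fact.out
  obtain ⟨b, r, hb⟩ := exists_eq_map_teichmuller_add_p_mul hq ω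
  obtain ⟨c, hc⟩ := hω
  have hjac : ω ^ (p - 1) * c ∈ (⊥ : Ideal A).jacobson := by
    refine Ideal.isRadical_jacobson _ ⟨p, mem_jacobson_bot_of_p_dvd hq ?_⟩
    have h : (ω ^ (p - 1) * c) ^ p = (p : A) ^ (p - 1) * c := by
      rw [hc, mul_pow, mul_pow, ← pow_mul, ← pow_mul, mul_comm (p - 1) p, mul_assoc, ← pow_succ,
        Nat.sub_add_cancel hp.one_le]
    rw [h]
    exact (dvd_pow_self _ (Nat.sub_ne_zero_of_lt hp.one_lt)).mul_right c
  have hunit := Ideal.mem_jacobson_bot.mp hjac (-r)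
  refine ⟨b, Associated.symm ⟨hunit.unit, ?_⟩⟩
  rw [IsUnit.unit_spec]
  have h : ω ^ p = ω * ω ^ (p - 1) := by rw [← pow_succ', Nat.sub_add_cancel hp.one_le]
  rw [h] at hc
  linear_combination hb + r * hc

theorem dvd_of_pow_dvd_pow (hq : Function.Surjective q) {a : k} {u : WittVector p k}
    (hker : ∀ w, q w = 0 ↔ teichmuller p a + p * u ∣ w) {ω x : A}
    (hω : ω ^ p ∣ (p : A)) (hx : ω ^ p ∣ x ^ p) : ω ∣ x := by
  have hp : p.Prime := Fact.out
  obtain ⟨b, hb⟩ := exists_associated_map_teichmuller hq hω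
  obtain ⟨y, r, rfl⟩ := exists_eq_map_teichmuller_add_p_mul hq x
  have hωp : ω ∣ (p : A) := (dvd_pow_self ω hp.ne_zero).trans hω
  refine dvd_add ?_ (hωp.mul_right r)
  have hy : ω ^ p ∣ q (teichmuller p y) ^ p := by
    obtain ⟨s, hs⟩ := exists_add_pow_prime_eq hp (q (teichmuller p y)) (p * r)
    rw [hs] at hx
    refine (dvd_add_left ?_).mp ((dvd_add_left ?_).mp hx)
    · exact (hω.mul_right r).trans (dvd_pow_self _ hp.ne_zero)
    · rw [mul_assoc, mul_assoc]
      exact hω.mul_right _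
  rw [← hb.dvd_iff_dvd_left]
  rw [← (hb.pow_pow (n := p)).dvd_iff_dvd_left, ← map_pow, ← map_pow] at hω hy
  have hd : q (teichmuller p a) + p * q u = 0 := by
    simpa using (hker _).mpr (dvd_refl _)
  have hcoeff : ∀ x : k, constantCoeff (teichmuller p x) = x := teichmuller_coeff_zero p
  have hp0 : constantCoeff (p : WittVector p k) = 0 := by simp
  obtain ⟨v, t, hv⟩ : ∃ v s : k, a * (1 - a * v) = b ^ p * s := by
    obtain ⟨c, hc⟩ := hω
    obtain ⟨c, rfl⟩ := hq c
    obtain ⟨e, he⟩ := (hker (p - teichmuller p (b ^ p) * c)).mp (by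
      rw [map_sub, map_mul, map_natCast, hc, map_pow, sub_self])
    exact exists_mul_one_sub_eq_of_p_sub_eq he
  obtain ⟨z, n, hz⟩ : ∃ z n : k, y ^ p = b ^ p * z + a * n := by
    obtain ⟨z, hz⟩ := hy
    obtain ⟨z, rfl⟩ := hq z
    obtain ⟨n, hn⟩ := (hker (teichmuller p (y ^ p) - teichmuller p (b ^ p) * z)).mp (by
      rw [map_sub, map_mul, map_pow, map_pow q, hz, sub_self])
    refine ⟨constantCoeff z, constantCoeff n, ?_⟩
    have := congrArg constantCoeff hn
    simp only [map_sub, map_mul, map_add, hcoeff, hp0] at this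
    linear_combination this
  have hdvd : b ^ p ∣ (y * (1 - a * v)) ^ p := by
    have h : b ^ p ∣ y ^ p * (1 - a * v) :=
      ⟨z * (1 - a * v) + t * n, by linear_combination (1 - a * v) * hz + n * hv⟩
    rw [mul_pow]
    exact h.trans (mul_dvd_mul_left _ (dvd_pow_self _ hp.ne_zero))
  obtain ⟨m, hm⟩ := hdvd
  obtain ⟨m, rfl⟩ := (PerfectRing.bijective_frobenius (R := k) (p := p)).surjective m
  have hm' : y * (1 - a * v) = b * m :=
    (PerfectRing.bijective_frobenius (R := k) (p := p)).injective (by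
      simpa only [mul_pow] using hm)
  have hunit : IsUnit (q (teichmuller p (1 - a * v))) := by
    obtain ⟨w, hw⟩ : (p : WittVector p k) ∣
        teichmuller p (1 - a * v) - (1 - teichmuller p a * teichmuller p v) := by
      rw [p_dvd_iff_coeff_zero_eq_zero]
      change constantCoeff
        (teichmuller p (1 - a * v) - (1 - teichmuller p a * teichmuller p v)) = 0
      simp only [map_sub, map_mul, map_one, hcoeff, sub_self]
    have hw' := congrArg q hw
    simp only [map_sub, map_mul, map_one, map_natCast] at hw'
    have h := Ideal.mem_jacobson_bot.mp (mem_jacobson_bot_of_p_dvd hq (dvd_refl (p : A)))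
      (q w + q u * q (teichmuller p v))
    convert h using 1
    linear_combination hw' - q (teichmuller p v) * hd
  rw [← hunit.dvd_mul_right, ← map_mul, ← map_mul, hm', map_mul, map_mul]
  exact dvd_mul_right _ _

end Quotient

end WittVector


/-- Let `p` be a prime, `R'` a perfect `𝔽_p`-algebra, `a : R'`, `u` a unit of
`W(R')`, and `R := W(R')/([a] + p·u)`. Then some `ω ∈ R` satisfies `ω ^ p ∣ p`, and for every
`ω ∈ R` with `ω ^ p ∣ p`, the ring homomorphism `R/(ω) → R/(ω^p)` induced by `x ↦ x ^ p` is
bijective. -/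
theorem perfectoid_frobenius_bijective (p : ℕ) [Fact p.Prime]
    (R' : Type*) [CommRing R'] [CharP R' p]
    (hperf : Function.Bijective fun x : R' => x ^ p)
    (a : R') (u : (WittVector p R')ˣ)
    (R : Type*) [CommRing R]
    (e : R ≃+* (WittVector p R' ⧸
      Ideal.span {WittVector.teichmuller p a + (p : WittVector p R') * (u : WittVector p R')})) :
    (∃ ω : R, ω ^ p ∣ (p : R)) ∧
    ∀ ω : R, ω ^ p ∣ (p : R) →
      ∃ f : (R ⧸ Ideal.span {ω}) →+* R ⧸ Ideal.span {ω ^ p},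
        (∀ x : R, f (Ideal.Quotient.mk (Ideal.span {ω}) x) =
            Ideal.Quotient.mk (Ideal.span {ω ^ p}) (x ^ p)) ∧
        Function.Bijective f := by
  have hp : p.Prime := Fact.out
  have : PerfectRing R' p := ⟨hperf⟩
  let q : WittVector p R' →+* R := e.symm.toRingHom.comp (Ideal.Quotient.mk _)
  have hq : Function.Surjective q := e.symm.surjective.comp Ideal.Quotient.mk_surjective
  have hker : ∀ w, q w = 0 ↔
      WittVector.teichmuller p a + (p : WittVector p R') * (u : WittVector p R') ∣ w := by
    intro w
    rw [← Ideal.mem_span_singleton, ← Ideal.Quotient.eq_zero_iff_mem]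
    exact e.symm.map_eq_zero_iff
  refine ⟨WittVector.exists_pow_dvd_p ((hker _).mpr (dvd_refl _)), fun ω hω => ?_⟩
  exact ⟨quotientPowHom hp hω, quotientPowHom_mk hp hω,
    quotientPowHom_injective hp hω fun _ => WittVector.dvd_of_pow_dvd_pow hq hker hω,
    quotientPowHom_surjective hp hω (WittVector.exists_p_dvd_pow_sub hq)⟩
end

section
/- Let p be a prime, R' a perfect 𝔽_p-algebra, a ∈ R', and u a unit of the ring of p-typical Witt vectors W(R'). Then reduction of Witt vectors modulo p (the zeroth-component ring homomorphism W(R') → R') induces a ring isomorphism W(R')/(p, [a] + p·u) ≅ R'/(a), where [a] is the Teichmüller lift of a. -/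
/-- Over a ring of characteristic `p` with surjective Frobenius, the kernel of the zeroth-component
map on Witt vectors is generated by `p`. -/
theorem WittVector.natCast_dvd_of_coeff_zero_eq_zero {p : ℕ} [Fact p.Prime] {R : Type*}
    [CommRing R] [CharP R p] (hsurj : Function.Surjective fun x : R => x ^ p)
    {x : WittVector p R} (hx : x.coeff 0 = 0) : (p : WittVector p R) ∣ x := by
  choose r hr using hsurj
  refine ⟨WittVector.mk p fun n => r (x.coeff (n + 1)), ?_⟩
  rw [mul_comm]
  ext n
  cases n with
  | zero => rw [WittVector.mul_charP_coeff_zero, hx]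
  | succ n => rw [WittVector.mul_charP_coeff_succ]; exact (hr _).symm

/-- The kernel of `W(R) → R → R/(a)` is generated by `p` and any `[a] + p * v`. -/
theorem WittVector.ker_mk_comp_constantCoeff {p : ℕ} [Fact p.Prime] {R : Type*}
    [CommRing R] [CharP R p] (hsurj : Function.Surjective fun x : R => x ^ p)
    (a : R) (v : WittVector p R) :
    RingHom.ker ((Ideal.Quotient.mk (Ideal.span {a})).comp
        (WittVector.constantCoeff : WittVector p R →+* R)) =
      Ideal.span {(p : WittVector p R), WittVector.teichmuller p a + (p : WittVector p R) * v} := by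
  apply le_antisymm
  · intro x hx
    rw [RingHom.mem_ker, RingHom.comp_apply, Ideal.Quotient.eq_zero_iff_mem,
      Ideal.mem_span_singleton'] at hx
    obtain ⟨b, hb⟩ := hx
    obtain ⟨y, hy⟩ := WittVector.natCast_dvd_of_coeff_zero_eq_zero hsurj
      (x := x - WittVector.teichmuller p b * WittVector.teichmuller p a) (by
        rw [← WittVector.constantCoeff_apply, map_sub, map_mul, ← hb]
        simp [WittVector.constantCoeff_apply])
    rw [Ideal.mem_span_pair]
    exact ⟨y - WittVector.teichmuller p b * v, WittVector.teichmuller p b, by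
      linear_combination -hy⟩
  · rw [Ideal.span_le]
    rintro x (rfl | rfl)
    · rw [SetLike.mem_coe, RingHom.mem_ker, RingHom.comp_apply, map_natCast, CharP.cast_eq_zero, map_zero]
    · rw [SetLike.mem_coe, RingHom.mem_ker, RingHom.comp_apply, Ideal.Quotient.eq_zero_iff_mem,
        map_add, map_mul]
      simp [WittVector.constantCoeff_apply]


/-- Let `p` be a prime, `R'` a perfect `𝔽_p`-algebra, `a : R'`, and `u` a unit of
`W(R')`. Then reduction modulo `p` (the zeroth-component ring homomorphism `W(R') → R'`) induces
a ring isomorphism `W(R')/(p, [a] + p·u) ≅ R'/(a)`. -/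
theorem witt_quotient_iso_tilt_quotient (p : ℕ) [Fact p.Prime]
    (R' : Type*) [CommRing R'] [CharP R' p]
    (hperf : Function.Bijective fun x : R' => x ^ p)
    (a : R') (u : (WittVector p R')ˣ) :
    ∃ e : (WittVector p R' ⧸
        Ideal.span {(p : WittVector p R'),
          WittVector.teichmuller p a + (p : WittVector p R') * (u : WittVector p R')}) ≃+*
        (R' ⧸ Ideal.span {a}),
      ∀ x : WittVector p R',
        e (Ideal.Quotient.mk _ x) = Ideal.Quotient.mk (Ideal.span {a}) (x.coeff 0) := by
  have hf : Function.Surjective ((Ideal.Quotient.mk (Ideal.span {a})).comp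
      (WittVector.constantCoeff : WittVector p R' →+* R')) :=
    Ideal.Quotient.mk_surjective.comp (WittVector.constantCoeff_surjective p)
  exact ⟨(Ideal.quotEquivOfEq (WittVector.ker_mk_comp_constantCoeff hperf.2 a u).symm).trans
    (RingHom.quotientKerEquivOfSurjective hf), fun _ => rfl⟩
end

section
/- Let p be a prime, R a perfect 𝔽_p-algebra, and n ≥ 1. Then the kernel of the truncation ring homomorphism W(R) → W_n(R) from the p-typical Witt vectors to the length-n truncated Witt vectors is the ideal generated by p^n. In particular, W(R)/(p) ≅ R. -/
/-- For a prime `p`, a perfect `𝔽_p`-algebra `R` and `n ≥ 1`, the kernel of the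
truncation map `W(R) → W_n(R)` is the ideal generated by `p ^ n`; in particular
`W(R)/(p) ≅ R`. -/
theorem witt_ker_truncate (p : ℕ) [Fact p.Prime] (R : Type*) [CommRing R] [CharP R p]
    (hperf : Function.Bijective fun x : R => x ^ p) (n : ℕ) (hn : 1 ≤ n) :
    RingHom.ker (WittVector.truncate (p := p) (R := R) n) =
      Ideal.span {(p : WittVector p R) ^ n} ∧
    Nonempty ((WittVector p R ⧸ Ideal.span {(p : WittVector p R)}) ≃+* R) := by
  have : PerfectRing R p := ⟨hperf⟩
  refine ⟨?_, ⟨WittVector.quotientPEquiv⟩⟩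
  ext x
  rw [WittVector.mem_ker_truncate, WittVector.mem_span_p_pow_iff_le_coeff_eq_zero]
end

section
/- Let p be a prime and R a perfect 𝔽_p-algebra. Then the ring of p-typical Witt vectors W(R) is p-adically complete, i.e., W(R) is Hausdorff and complete for the topology defined by the ideal (p). -/
/-- For a prime `p` and a perfect `𝔽_p`-algebra `R`, the ring of `p`-typical
Witt vectors `W(R)` is `p`-adically complete. -/
theorem witt_isAdicComplete (p : ℕ) [Fact p.Prime] (R : Type*) [CommRing R] [CharP R p]
    (hperf : Function.Bijective fun x : R => x ^ p) :
    IsAdicComplete (Ideal.span {(p : WittVector p R)}) (WittVector p R) := by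
  have : PerfectRing R p := ⟨by simpa using hperf⟩
  exact WittVector.isAdicCompleteIdealSpanP
end

section
/- Let p be a prime, R a perfect 𝔽_p-algebra, and x ∈ R an element such that R is x-adically complete. Then the canonical ring homomorphism from R to the inverse-limit perfection of R/(x) (the lift, along the perfectness of R, of the quotient map R → R/(x)) is bijective; i.e., R agrees with the inverse limit of R/(x) along Frobenius. -/
/-- In a perfect ring, divisibility by `x` can be tested after raising to the `p ^ n`-th power. -/
theorem pow_expChar_pow_dvd_pow_expChar_pow_iff {R : Type*} [CommRing R] (p : ℕ) [ExpChar R p]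
    [PerfectRing R p] (n : ℕ) {x a : R} : x ^ p ^ n ∣ a ^ p ^ n ↔ x ∣ a := by
  refine ⟨fun ⟨c, hc⟩ => ?_, fun h => pow_dvd_pow_of_dvd h _⟩
  obtain ⟨d, rfl⟩ := (bijective_iterateFrobenius R p n).surjective c
  rw [iterateFrobenius_def, ← mul_pow] at hc
  exact ⟨d, (bijective_iterateFrobenius R p n).injective (by simpa [iterateFrobenius_def] using hc)⟩

theorem iterate_frobeniusEquiv_symm_pow_expChar_pow {R : Type*} [CommRing R] (p : ℕ) [ExpChar R p]
    [PerfectRing R p] (n : ℕ) (r : R) : ((⇑(frobeniusEquiv R p).symm)^[n] r) ^ p ^ n = r := by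
  induction n generalizing r with
  | zero => simp
  | succ n ih =>
    rw [Function.iterate_succ_apply', pow_succ', pow_mul, frobeniusEquiv_symm_pow_p, ih]

theorem smodEq_span_singleton_pow_iff_dvd {R : Type*} [CommRing R] (x : R) (n : ℕ) {a b : R} :
    a ≡ b [SMOD (Ideal.span {x} ^ n • ⊤ : Submodule R R)] ↔ x ^ n ∣ a - b := by
  rw [SModEq.sub_mem, smul_eq_mul, Ideal.mul_top, Ideal.span_singleton_pow,
    Ideal.mem_span_singleton]

/-- Let `p` be a prime and `R` a perfect `𝔽_p`-algebra which is `x`-adically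
complete for some `x : R`. Then the canonical ring homomorphism from `R` to the inverse-limit
perfection of `R/(x)` (the lift, along perfectness of `R`, of the quotient map `R → R/(x)`) is
bijective: `R` agrees with the inverse limit of `R/(x)` along Frobenius. -/
theorem bijective_to_perfection_of_adicComplete (p : ℕ) [Fact p.Prime]
    (R : Type*) [CommRing R] [CharP R p] [ExpChar R p] [PerfectRing R p]
    (x : R) (hcomplete : IsAdicComplete (Ideal.span {x}) R) :
    Function.Bijective
      (fun r : R =>
        (⟨fun n => Ideal.Quotient.mk (Ideal.span {x}) ((⇑(frobeniusEquiv R p).symm)^[n] r),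
          fun n => by
            rw [← map_pow, Function.iterate_succ_apply', frobeniusEquiv_symm_pow_p]⟩ :
          Ring.Perfection (R ⧸ Ideal.span {x}) p)) := by
  have dvd_iff (n : ℕ) (a r : R) :
      Ideal.Quotient.mk (Ideal.span {x}) a =
          Ideal.Quotient.mk (Ideal.span {x}) ((⇑(frobeniusEquiv R p).symm)^[n] r) ↔
        x ^ p ^ n ∣ a ^ p ^ n - r := by
    rw [Ideal.Quotient.mk_eq_mk_iff_sub_mem, Ideal.mem_span_singleton,
      ← pow_expChar_pow_dvd_pow_expChar_pow_iff p n, sub_pow_expChar_pow,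
      iterate_frobeniusEquiv_symm_pow_expChar_pow]
  have le_pow (n : ℕ) : n ≤ p ^ n := (Nat.lt_pow_self (Fact.out : p.Prime).one_lt).le
  constructor
  · intro r s h
    refine hcomplete.toIsHausdorff.eq_iff_smodEq.2 fun n => ?_
    have hn := (dvd_iff n _ s).1 (congrFun (congrArg Subtype.val h) n)
    rw [iterate_frobeniusEquiv_symm_pow_expChar_pow] at hn
    exact (smodEq_span_singleton_pow_iff_dvd x n).2 ((pow_dvd_pow x (le_pow n)).trans hn)
  · rintro ⟨f, hf⟩
    choose g hg using fun n => Ideal.Quotient.mk_surjective (f n)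
    have step (n : ℕ) : x ^ p ^ n ∣ g n ^ p ^ n - g (n + 1) ^ p ^ (n + 1) := by
      rw [pow_succ' p n, pow_mul, ← sub_pow_expChar_pow, pow_expChar_pow_dvd_pow_expChar_pow_iff,
        ← Ideal.mem_span_singleton, ← Ideal.Quotient.mk_eq_mk_iff_sub_mem, map_pow, hg, hg, hf]
    have cauchy {m n : ℕ} (hmn : m ≤ n) : x ^ p ^ m ∣ g m ^ p ^ m - g n ^ p ^ n := by
      induction n, hmn using Nat.le_induction with
      | base => simp
      | succ n hmn ih =>
        rw [← sub_add_sub_cancel _ (g n ^ p ^ n)]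
        exact dvd_add ih ((pow_dvd_pow x
          (Nat.pow_le_pow_right (Fact.out : p.Prime).pos hmn)).trans (step n))
    obtain ⟨L, hL⟩ := hcomplete.toIsPrecomplete.prec (f := fun n => g n ^ p ^ n) fun {m n} hmn =>
      (smodEq_span_singleton_pow_iff_dvd x m).2 ((pow_dvd_pow x (le_pow m)).trans (cauchy hmn))
    refine ⟨L, Subtype.ext (funext fun n => ?_)⟩
    change Ideal.Quotient.mk _ _ = f n
    rw [← hg n, eq_comm, dvd_iff, ← sub_add_sub_cancel _ (g (p ^ n) ^ p ^ p ^ n)]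
    exact dvd_add (cauchy (le_pow n)) ((smodEq_span_singleton_pow_iff_dvd x _).1 (hL (p ^ n)))
end

section
/- Let p be a prime and S a commutative ring of characteristic p. Then the map on the first André–Quillen homology H¹Cotangent(𝔽_p, S) → H¹Cotangent(𝔽_p, S) functorially induced by the Frobenius endomorphism φ : S → S, x ↦ x^p (an 𝔽_p-algebra homomorphism) is the zero map. -/
/-- Renaming variables along an algebra isomorphism `σ : S ≃ T` commutes with evaluating each
variable at the element it is indexed by. -/
theorem MvPolynomial.aeval_id_rename_algEquiv {R S T : Type*} [CommRing R] [CommRing S]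
    [CommRing T] [Algebra R S] [Algebra R T] (σ : S ≃ₐ[R] T) (x : MvPolynomial S R) :
    aeval (id : T → T) (rename σ x) = σ (aeval (id : S → S) x) := by
  rw [aeval_rename]
  exact (comp_aeval_apply id σ.toAlgHom x).symm

open MvPolynomial in
/-- For `S` an algebra over `ZMod p` and `σ : S ≃ T` such that `S → T` is `σ ∘ (x ↦ x ^ p)`, the
composition of `X s ↦ X (σ s)` with the Frobenius, as a morphism between the
standard presentations of `S` and `T`. -/
noncomputable def Algebra.Generators.selfFrobeniusHom (p : ℕ) [Fact p.Prime]
    {S T : Type*} [CommRing S] [CommRing T]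
    [Algebra (ZMod p) S] [Algebra (ZMod p) T] [Algebra S T]
    (σ : S ≃ₐ[ZMod p] T) (hσ : ∀ s : S, algebraMap S T s = σ (s ^ p)) :
    (self (ZMod p) S).toExtension.Hom (self (ZMod p) T).toExtension where
  toRingHom := (frobenius (MvPolynomial T (ZMod p)) p).comp
    (rename (R := ZMod p) σ : MvPolynomial S (ZMod p) →ₐ[ZMod p] MvPolynomial T (ZMod p)).toRingHom
  toRingHom_algebraMap r := by
    change (rename σ (C r : MvPolynomial S (ZMod p))) ^ p = C (algebraMap (ZMod p) (ZMod p) r)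
    rw [rename_C, ← map_pow, ZMod.pow_card, Algebra.algebraMap_self_apply]
  algebraMap_toRingHom x := by
    change aeval (R := ZMod p) (_root_.id : T → T) ((rename σ x) ^ p) =
      algebraMap S T (aeval (R := ZMod p) (_root_.id : S → S) x)
    rw [hσ, map_pow, map_pow]
    exact congrArg (· ^ p) (aeval_id_rename_algEquiv σ x)

/-- Let `p` be a prime and `S` a commutative ring of characteristic `p`. The
map on first André–Quillen homology `H¹Cotangent(𝔽_p, S) → H¹Cotangent(𝔽_p, S)` functorially
induced by the Frobenius `x ↦ x ^ p` is zero. (The Frobenius endomorphism is encoded by an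
`𝔽_p`-algebra `T` together with a `𝔽_p`-algebra isomorphism `σ : S ≃ T` such that the structure
map `S → T` is `σ ∘ (x ↦ x ^ p)`; the induced map `H¹Cotangent(𝔽_p, S) → H¹Cotangent(𝔽_p, T)`
vanishes.) -/
theorem frobenius_induces_zero_on_H1Cotangent (p : ℕ) (hp : p.Prime)
    (S T : Type*) [CommRing S] [CommRing T] [CharP S p]
    [Algebra (ZMod p) S] [Algebra (ZMod p) T] [Algebra S T] [IsScalarTower (ZMod p) S T]
    (σ : S ≃ₐ[ZMod p] T) (hσ : ∀ s : S, algebraMap S T s = σ (s ^ p)) :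
    Algebra.H1Cotangent.map (ZMod p) (ZMod p) S T = 0 := by
  have : Fact p.Prime := ⟨hp⟩
  rw [Algebra.H1Cotangent.map, Algebra.Extension.H1Cotangent.map_eq _
    (Algebra.Generators.selfFrobeniusHom p σ hσ)]
  ext1 x
  apply Algebra.Extension.h1Cotangentι_ext
  obtain ⟨y, hy⟩ := Algebra.Extension.Cotangent.mk_surjective x.1
  change Algebra.Extension.Cotangent.map (Algebra.Generators.selfFrobeniusHom p σ hσ) x.1 = 0
  rw [← hy, Algebra.Extension.Cotangent.map_mk, Algebra.Extension.Cotangent.mk_eq_zero_iff]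
  have h : MvPolynomial.rename (R := ZMod p) σ y.1 ∈
      (Algebra.Generators.self (ZMod p) T).toExtension.ker := by
    change MvPolynomial.aeval (R := ZMod p) (id : T → T) (MvPolynomial.rename σ y.1) = 0
    have hy0 : MvPolynomial.aeval (R := ZMod p) (id : S → S) y.1 = 0 := y.2
    exact (MvPolynomial.aeval_id_rename_algEquiv σ y.1).trans
      ((congrArg σ hy0).trans (map_zero σ))
  exact Ideal.pow_le_pow_right hp.two_le (Ideal.pow_mem_pow h p)
end

section
/- Let p be a prime and R a perfect 𝔽_p-algebra. Then the first André–Quillen homology of the cotangent complex vanishes: H¹Cotangent(𝔽_p, R) = 0. -/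
/-- In characteristic `p`, the Frobenius of `B` factors through the quotient by a square-zero
ideal. -/
def Ideal.Quotient.liftFrobenius {B : Type*} [CommRing B] (p : ℕ) [Fact p.Prime] [CharP B p]
    (I : Ideal B) (hI : I ^ 2 = ⊥) : B ⧸ I →+* B :=
  Ideal.Quotient.lift I (frobenius B p) fun i hi ↦ by
    have h : i ^ 2 = 0 := by simpa [hI] using Ideal.pow_mem_pow hi 2
    rw [frobenius_def]
    exact pow_eq_zero_of_le (Fact.out : p.Prime).two_le h

theorem Ideal.Quotient.mk_liftFrobenius {B : Type*} [CommRing B] (p : ℕ) [Fact p.Prime]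
    [CharP B p] (I : Ideal B) (hI : I ^ 2 = ⊥) (x : B ⧸ I) :
    Ideal.Quotient.mk I (Ideal.Quotient.liftFrobenius p I hI x) = x ^ p := by
  obtain ⟨b, rfl⟩ := Ideal.Quotient.mk_surjective x
  rw [liftFrobenius, Ideal.Quotient.lift_mk, frobenius_def, map_pow]

theorem Algebra.FormallySmooth.zmod_of_perfectRing (p : ℕ) [Fact p.Prime] (R : Type*) [CommRing R]
    [CharP R p] [Algebra (ZMod p) R] [PerfectRing R p] : Algebra.FormallySmooth (ZMod p) R := by
  refine .of_comp_surjective fun B _ _ I hI f ↦ ?_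
  cases subsingleton_or_nontrivial B with
  | inl _ =>
    have : Subsingleton (B ⧸ I) := Ideal.Quotient.mk_surjective.subsingleton
    let g : R →+* B :=
      { toFun := 0
        map_one' := Subsingleton.elim _ _
        map_mul' _ _ := Subsingleton.elim _ _
        map_zero' := rfl
        map_add' _ _ := Subsingleton.elim _ _ }
    exact ⟨{ g with commutes' := fun _ ↦ Subsingleton.elim _ _ },
      AlgHom.ext fun _ ↦ Subsingleton.elim _ _⟩
  | inr _ =>
    have : CharP B p := charP_of_injective_algebraMap (algebraMap (ZMod p) B).injective p
    let g : R →+* B := (Ideal.Quotient.liftFrobenius p I hI).comp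
      ((f : R →+* B ⧸ I).comp ((frobeniusEquiv R p).symm : R →+* R))
    refine ⟨{ g with commutes' := RingHom.congr_fun (Subsingleton.elim
      (g.comp (algebraMap (ZMod p) R)) (algebraMap (ZMod p) B)) }, AlgHom.ext fun x ↦ ?_⟩
    calc Ideal.Quotient.mk I (g x) = f ((frobeniusEquiv R p).symm x) ^ p :=
          Ideal.Quotient.mk_liftFrobenius p I hI _
      _ = f x := by rw [← map_pow, frobeniusEquiv_symm_pow_p]

/-- For a prime `p` and a perfect `𝔽_p`-algebra `R`, the first André–Quillen
homology of the cotangent complex vanishes: `H¹Cotangent(𝔽_p, R) = 0`. -/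
theorem h1Cotangent_eq_zero_of_perfect (p : ℕ) (hp : p.Prime)
    (R : Type*) [CommRing R] [CharP R p] [Algebra (ZMod p) R]
    (hperf : Function.Bijective fun x : R => x ^ p) :
    Subsingleton (Algebra.H1Cotangent (ZMod p) R) := by
  have : Fact p.Prime := ⟨hp⟩
  have : PerfectRing R p := ⟨hperf⟩
  exact (Algebra.FormallySmooth.zmod_of_perfectRing p R).subsingleton_h1Cotangent
end

section
/- Let p be a prime and V a valuation ring of characteristic p (so V is an 𝔽_p-algebra). Then the cotangent complex of V over 𝔽_p is a flat V-module concentrated in degree zero; concretely: the module of Kähler differentials Ω¹_{V/𝔽_p} is a flat V-module, and the first André–Quillen homology H¹Cotangent(𝔽_p, V) vanishes. -/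
open Algebra

/-- Linear combinations, with coefficients `p`-th powers, of the monomials in the family `x`
whose exponents are all less than `p`. -/
def pthPowerCombination (p : ℕ) {S : Type*} [CommRing S] {n : ℕ} (x : Fin n → S)
    (c : (Fin n → Fin p) → S) : S :=
  ∑ α, c α ^ p * ∏ i, x i ^ (α i : ℕ)

section FormalConsequences

variable {R S : Type*} [CommRing R] [CommRing S] [Algebra R S]

lemma subsingleton_h1Cotangent_of_exists_hom (P : Extension R S)
    (h : ∀ x : P.Cotangent, ∃ φ : P.Hom P, Extension.Cotangent.map φ x = 0) :
    Subsingleton P.H1Cotangent := by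
  refine subsingleton_of_forall_eq 0 fun x ↦ ?_
  obtain ⟨φ, hφ⟩ := h x.1
  have h1 : Extension.H1Cotangent.map φ x = x := by
    rw [Extension.H1Cotangent.map_eq φ (.id P), Extension.H1Cotangent.map_id, LinearMap.id_apply]
  rw [← h1]
  exact Extension.h1Cotangentι_ext _ _ hφ

lemma kaehlerDifferential_smul_eq_zero_of_exists_hom (P : Extension R S)
    [Module.Free S P.CotangentSpace] [IsDomain S]
    (h : ∀ x : P.Cotangent, ∃ φ : P.Hom P, Extension.Cotangent.map φ x = 0)
    {c : S} (hc : c ≠ 0) {ω : KaehlerDifferential R S} (hω : c • ω = 0) : ω = 0 := by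
  obtain ⟨η, rfl⟩ := P.toKaehler_surjective ω
  rw [← map_smul] at hω
  obtain ⟨x, hx⟩ := (P.exact_cotangentComplex_toKaehler _).1 hω
  obtain ⟨φ, hφ⟩ := h x
  have h1 : Extension.CotangentSpace.map φ η = 0 := by
    have : c • Extension.CotangentSpace.map φ η = 0 := by
      rw [← map_smul, ← hx, Extension.CotangentSpace.map_cotangentComplex, hφ, map_zero]
    exact (smul_eq_zero.1 this).resolve_left hc
  have h2 := DFunLike.congr_fun (Extension.CotangentSpace.map_sub_map (Extension.Hom.id P) φ) η
  rw [LinearMap.sub_apply, h1, sub_zero, Extension.CotangentSpace.map_id] at h2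
  have h3 : η = P.cotangentComplex ((Extension.Hom.id P).sub φ η) := h2
  rw [h3]
  exact P.exact_cotangentComplex_toKaehler.apply_apply_eq_zero _

end FormalConsequences

section PthPowerCombination

variable {p : ℕ} [Fact p.Prime] {S : Type*} [CommRing S] [CharP S p] {n : ℕ} (x : Fin n → S)

lemma pthPowerCombination_add (c d : (Fin n → Fin p) → S) :
    pthPowerCombination p x (c + d) = pthPowerCombination p x c + pthPowerCombination p x d := by
  simp [pthPowerCombination, add_pow_char, add_mul, Finset.sum_add_distrib]

omit [CharP S p] in
lemma exists_pthPowerCombination_eq_mul_prod (a : S) (m : Fin n → ℕ) :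
    ∃ c, pthPowerCombination p x c = a ^ p * ∏ i, x i ^ m i := by
  have hp : 0 < p := (Fact.out : p.Prime).pos
  refine ⟨Pi.single (fun i ↦ ⟨m i % p, Nat.mod_lt _ hp⟩) (a * ∏ i, x i ^ (m i / p)), ?_⟩
  rw [pthPowerCombination, Finset.sum_eq_single (fun i ↦ ⟨m i % p, Nat.mod_lt _ hp⟩)]
  · simp only [Pi.single_eq_same, mul_pow, ← Finset.prod_pow, mul_assoc, ← Finset.prod_mul_distrib]
    congr 1
    refine Finset.prod_congr rfl fun i _ ↦ ?_
    rw [← pow_mul, ← pow_add, mul_comm, Nat.div_add_mod]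
  · intro α _ hα
    simp [Pi.single_eq_of_ne hα, hp.ne']
  · simp

variable (p) in
/-- The subring generated by all `p`-th powers and the family `x`. -/
def pthPowerSubring : Subring S where
  carrier := Set.range (pthPowerCombination p x)
  zero_mem' := ⟨0, by simp [pthPowerCombination, (Fact.out : p.Prime).ne_zero]⟩
  one_mem' := by simpa using exists_pthPowerCombination_eq_mul_prod x (1 : S) 0
  add_mem' := by
    rintro _ _ ⟨c, rfl⟩ ⟨d, rfl⟩
    exact ⟨c + d, pthPowerCombination_add (p := p) x c d⟩
  neg_mem' := by
    rintro _ ⟨c, rfl⟩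
    refine ⟨-c, ?_⟩
    rw [eq_neg_iff_add_eq_zero, ← pthPowerCombination_add, neg_add_cancel]
    simp [pthPowerCombination, (Fact.out : p.Prime).ne_zero]
  mul_mem' := by
    have sum_mem : ∀ (s : Finset ((Fin n → Fin p) × (Fin n → Fin p)))
        (f : (Fin n → Fin p) × (Fin n → Fin p) → S),
        (∀ i ∈ s, f i ∈ Set.range (pthPowerCombination p x)) →
        ∑ i ∈ s, f i ∈ Set.range (pthPowerCombination p x) := by
      classical
      intro s f
      induction s using Finset.induction_on with
      | empty =>
        exact fun _ ↦ ⟨0, by simp [pthPowerCombination, (Fact.out : p.Prime).ne_zero]⟩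
      | insert i s hi ih =>
        intro h
        obtain ⟨c, hc⟩ := h i (by simp)
        obtain ⟨d, hd⟩ := ih fun j hj ↦ h j (by simp [hj])
        exact ⟨c + d, by rw [pthPowerCombination_add, hc, hd, Finset.sum_insert hi]⟩
    rintro _ _ ⟨c, rfl⟩ ⟨d, rfl⟩
    rw [pthPowerCombination, pthPowerCombination, Finset.sum_mul_sum, ← Finset.sum_product']
    refine sum_mem _ _ fun i _ ↦ ?_
    obtain ⟨e, he⟩ := exists_pthPowerCombination_eq_mul_prod (p := p) x (c i.1 * d i.2)
      (fun j ↦ (i.1 j : ℕ) + i.2 j)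
    refine ⟨e, ?_⟩
    rw [he]
    simp only [pow_add, Finset.prod_mul_distrib]
    ring

lemma mem_pthPowerSubring {s : S} :
    s ∈ pthPowerSubring p x ↔ ∃ c, pthPowerCombination p x c = s := Iff.rfl

end PthPowerCombination

section Generators

variable {p : ℕ} [Fact p.Prime] {V : Type*} [CommRing V] [Algebra (ZMod p) V]

lemma exists_aeval_mem_ker_sq
    (h : ∀ S : Finset V, ∃ (n : ℕ) (x : Fin n → V),
      (∀ c, pthPowerCombination p x c = 0 → c = 0) ∧ ∀ s ∈ S, ∃ c, pthPowerCombination p x c = s)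
    (f : MvPolynomial V (ZMod p)) (hf : MvPolynomial.aeval (id : V → V) f = 0) :
    ∃ g : V → MvPolynomial V (ZMod p), (∀ s, MvPolynomial.aeval (id : V → V) (g s) = s) ∧
      MvPolynomial.aeval g f ∈
        RingHom.ker (MvPolynomial.aeval (id : V → V) : MvPolynomial V (ZMod p) →ₐ[ZMod p] V) ^ 2 := by
  classical
  obtain ⟨n, x, hx, hS⟩ := h f.vars
  choose! c hc using hS
  let X' : Fin n → MvPolynomial V (ZMod p) := fun i ↦ MvPolynomial.X (x i)
  have haev : ∀ d : (Fin n → Fin p) → MvPolynomial V (ZMod p),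
      MvPolynomial.aeval (id : V → V) (pthPowerCombination p X' d) =
        pthPowerCombination p x fun α ↦ MvPolynomial.aeval (id : V → V) (d α) := by
    intro d
    simp [pthPowerCombination, X']
  let g : V → MvPolynomial V (ZMod p) := fun s ↦
    if s ∈ f.vars then pthPowerCombination p X' fun α ↦ MvPolynomial.X (c s α)
    else MvPolynomial.X s
  have hg : ∀ s, MvPolynomial.aeval (id : V → V) (g s) = s := by
    intro s
    by_cases hs : s ∈ f.vars
    · simp only [g, if_pos hs, haev]
      simpa using hc s hs
    · simp [g, if_neg hs]
  refine ⟨g, hg, ?_⟩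
  have hmem : MvPolynomial.aeval g f ∈ pthPowerSubring p X' := by
    rw [MvPolynomial.aeval_def, MvPolynomial.eval₂_eq]
    refine Subring.sum_mem _ fun m hm ↦ Subring.mul_mem _ ?_ (Subring.prod_mem _ fun s hs ↦
      Subring.pow_mem _ ?_ _)
    · rw [mem_pthPowerSubring]
      obtain ⟨e, he⟩ := exists_pthPowerCombination_eq_mul_prod (p := p) X'
        (algebraMap (ZMod p) (MvPolynomial V (ZMod p)) (f.coeff m)) 0
      refine ⟨e, he.trans ?_⟩
      rw [← map_pow, ZMod.pow_card]
      simp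
    · have : s ∈ f.vars := (MvPolynomial.mem_vars_iff_mem_support _).2 ⟨m, hm, hs⟩
      simp only [g, if_pos this]
      exact ⟨_, rfl⟩
  obtain ⟨G, hG⟩ := hmem
  have hG0 : (fun α ↦ MvPolynomial.aeval (id : V → V) (G α)) = 0 := by
    apply hx
    rw [← haev, hG, ← hf, ← AlgHom.comp_apply]
    congr 1
    ext s
    simp [hg]
  rw [← hG, pthPowerCombination]
  refine Ideal.sum_mem _ fun α _ ↦ Ideal.mul_mem_right _ _ ?_
  exact Ideal.pow_le_pow_right (Fact.out : p.Prime).two_le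
    (Ideal.pow_mem_pow (congr_fun hG0 α) p)

lemma exists_hom_cotangent_map_eq_zero
    (h : ∀ S : Finset V, ∃ (n : ℕ) (x : Fin n → V),
      (∀ c, pthPowerCombination p x c = 0 → c = 0) ∧ ∀ s ∈ S, ∃ c, pthPowerCombination p x c = s)
    (y : (Generators.self (ZMod p) V).toExtension.Cotangent) :
    ∃ φ : (Generators.self (ZMod p) V).toExtension.Hom (Generators.self (ZMod p) V).toExtension,
      Extension.Cotangent.map φ y = 0 := by
  have hker := Generators.ker_eq_ker_aeval_val (Generators.self (ZMod p) V)
  obtain ⟨⟨f, hf⟩, rfl⟩ := Extension.Cotangent.mk_surjective y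
  have hf' : f ∈ RingHom.ker (MvPolynomial.aeval (Generators.self (ZMod p) V).val) := by
    rw [← hker]; exact hf
  obtain ⟨g, hg, hmem⟩ := exists_aeval_mem_ker_sq h f hf'
  let φ : (Generators.self (ZMod p) V).Hom (Generators.self (ZMod p) V) := ⟨g, hg⟩
  refine ⟨φ.toExtensionHom, ?_⟩
  rw [Extension.Cotangent.map_mk, Extension.Cotangent.mk_eq_zero_iff]
  change MvPolynomial.aeval g f ∈ (Generators.self (ZMod p) V).ker ^ 2
  rw [hker]
  exact hmem

end Generators

open Polynomial IsLocalRing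

section PthRoots

variable {p : ℕ} [Fact p.Prime] {E L : Type*} [Field E] [Field L] [CharP L p] [Algebra E L]

lemma minpoly_eq_X_pow_sub_C {x : L} (hx : x ∉ Set.range (algebraMap E L)) {e : E}
    (he : algebraMap E L e = x ^ p) : minpoly E x = X ^ p - C e := by
  have hp : p.Prime := Fact.out
  refine (minpoly.eq_of_irreducible_of_monic (X_pow_sub_C_irreducible_of_prime hp fun b hb ↦
    hx ⟨b, ?_⟩) (by simp [he]) (monic_X_pow_sub_C e hp.ne_zero)).symm
  apply frobenius_inj L p
  simp only [frobenius_def, ← map_pow, hb, he]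

lemma aeval_ne_zero_of_natDegree_lt {x : L} (hx : x ∉ Set.range (algebraMap E L))
    (he : x ^ p ∈ Set.range (algebraMap E L)) {g : E[X]} (hg : g ≠ 0) (hgp : g.natDegree < p) :
    aeval x g ≠ 0 := by
  obtain ⟨e, he⟩ := he
  intro h0
  have := natDegree_le_of_dvd (minpoly.dvd E x h0) hg
  rw [minpoly_eq_X_pow_sub_C hx he, natDegree_X_pow_sub_C] at this
  omega

lemma exists_aeval_eq_of_notMem_range (hfin : Module.finrank E L = p) {x : L}
    (hx : x ∉ Set.range (algebraMap E L)) (he : x ^ p ∈ Set.range (algebraMap E L)) (w : L) :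
    ∃ g : E[X], g.natDegree < p ∧ aeval x g = w := by
  obtain ⟨e, he⟩ := he
  have hp : p.Prime := Fact.out
  have : FiniteDimensional E L := Module.finite_of_finrank_pos (hfin ▸ hp.pos)
  have hmin := minpoly_eq_X_pow_sub_C hx he
  have htop : IntermediateField.adjoin E {x} = ⊤ := by
    refine IntermediateField.eq_of_le_of_finrank_le le_top ?_
    rw [IntermediateField.adjoin.finrank (IsIntegral.of_finite E x), hmin, natDegree_X_pow_sub_C,
      IntermediateField.finrank_top', hfin]
  have hw : w ∈ (IntermediateField.adjoin E {x}).toSubalgebra := by rw [htop]; trivial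
  rw [IntermediateField.adjoin_simple_toSubalgebra_of_isAlgebraic (.of_finite E x),
    Algebra.adjoin_singleton_eq_range_aeval] at hw
  obtain ⟨g, rfl⟩ := hw
  refine ⟨g %ₘ minpoly E x, ?_, ?_⟩
  · have := natDegree_modByMonic_lt g (minpoly.monic (.of_finite E x)) (minpoly.ne_one E x)
    rwa [hmin, natDegree_X_pow_sub_C, ← hmin] at this
  · exact minpoly.aeval_modByMonic_minpoly g x

end PthRoots

section Normalization

variable {E Γ : Type*} [Field E] [LinearOrderedCommGroupWithZero Γ] {v : Valuation E Γ}
  {O : Type*} [CommRing O] [IsLocalRing O] [Algebra O E]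

lemma Valuation.Integers.residue_ne_zero_iff (hO : v.Integers O) {a : O} :
    residue O a ≠ 0 ↔ v (algebraMap O E a) = 1 := by
  rw [residue_ne_zero_iff_isUnit, hO.isUnit_iff_valuation_eq_one]

lemma Valuation.Integers.exists_eq_C_mul_map (hO : v.Integers O) {g : E[X]} (hg : g ≠ 0) :
    ∃ (s : E) (H : O[X]), s ≠ 0 ∧ g = C s * H.map (algebraMap O E) ∧ H.map (residue O) ≠ 0 := by
  obtain ⟨i, hi, hmax⟩ := g.support.exists_max_image (fun i ↦ v (g.coeff i))
    (support_nonempty.2 hg)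
  have hi0 : g.coeff i ≠ 0 := mem_support_iff.1 hi
  have hle : ∀ j, v ((C (g.coeff i)⁻¹ * g).coeff j) ≤ 1 := by
    intro j
    rw [coeff_C_mul, map_mul, map_inv₀]
    by_cases hj : j ∈ g.support
    · exact inv_mul_le_one_of_le₀ (hmax j hj) zero_le
    · simp [notMem_support_iff.1 hj]
  have hlift : C (g.coeff i)⁻¹ * g ∈ lifts (algebraMap O E) := by
    rw [lifts_iff_coeff_lifts]
    exact fun j ↦ hO.exists_of_le_one (hle j)
  obtain ⟨H, hH⟩ := hlift
  replace hH : H.map (algebraMap O E) = C (g.coeff i)⁻¹ * g := hH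
  refine ⟨g.coeff i, H, hi0, ?_, ?_⟩
  · rw [hH, ← mul_assoc, ← C_mul, mul_inv_cancel₀ hi0, C_1, one_mul]
  · intro h0
    have h1 : residue O (H.coeff i) = 0 := by rw [← coeff_map, h0, coeff_zero]
    refine (hO.residue_ne_zero_iff (a := H.coeff i)).2 ?_ h1
    rw [← coeff_map, hH, coeff_C_mul, inv_mul_cancel₀ hi0, map_one]

end Normalization

universe u

section Residue

variable {E : Type*} {L : Type u} {Γ : Type*} [Field E] [Field L]
  [LinearOrderedCommGroupWithZero Γ] [Algebra E L]
  {v : Valuation L Γ} {O : Type*} [CommRing O] [IsLocalRing O] [Algebra O E] [Algebra O L]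
  [IsScalarTower O E L]

lemma Valuation.Integers.exists_residueField_hom (hO : (v.comap (algebraMap E L)).Integers O) :
    ∃ (k : Type u) (_ : Field k) (σ : ResidueField O →+* k), ∀ z : L, v z ≤ 1 → ∃ ζ : k,
      ∀ H : O[X], v (aeval z H) = 1 ↔ eval₂ σ ζ (H.map (residue O)) ≠ 0 := by
  have hW : v.Integers v.integer := integer.integers v
  have : IsLocalRing v.integer := inferInstanceAs (IsLocalRing v.valuationSubring)
  have hle (a : O) : v (algebraMap O L a) ≤ 1 := by
    rw [IsScalarTower.algebraMap_apply O E L]; exact hO.map_le_one a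
  let f : O →+* v.integer := (algebraMap O L).codRestrict v.integer hle
  have hf : IsLocalHom f := by
    refine ⟨fun a ha ↦ ?_⟩
    rw [hO.isUnit_iff_valuation_eq_one]
    rw [hW.isUnit_iff_valuation_eq_one] at ha
    change v (algebraMap E L (algebraMap O E a)) = 1
    rw [← IsScalarTower.algebraMap_apply O E L]
    exact ha
  refine ⟨ResidueField v.integer, inferInstance, ResidueField.map f, fun z hz ↦
    ⟨residue v.integer ⟨z, hz⟩, fun H ↦ ?_⟩⟩
  have h1 : eval₂ (ResidueField.map f) (residue v.integer ⟨z, hz⟩) (H.map (residue O)) =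
      residue v.integer (eval₂ f ⟨z, hz⟩ H) := by
    rw [eval₂_map, hom_eval₂]
    rfl
  rw [h1, hW.residue_ne_zero_iff]
  have h2 : algebraMap v.integer L (eval₂ f ⟨z, hz⟩ H) = aeval z H := by
    rw [hom_eval₂]
    rfl
  rw [h2]

/-- Evaluating an integral polynomial at an element congruent to `τ ∈ O`. -/
lemma Valuation.Integers.valuation_aeval_eq_one_iff (hO : (v.comap (algebraMap E L)).Integers O)
    {z : L} {τ : O} (h : v (z - algebraMap O L τ) < 1) (H : O[X]) :
    v (aeval z H) = 1 ↔ (H.map (residue O)).eval (residue O τ) ≠ 0 := by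
  have hτ : v (algebraMap O L τ) ≤ 1 := by
    rw [IsScalarTower.algebraMap_apply O E L]; exact hO.map_le_one τ
  have hz : v z ≤ 1 := by
    rw [← sub_add_cancel z (algebraMap O L τ)]
    exact v.map_add_le h.le hτ
  obtain ⟨k, _, σ, hσ⟩ := hO.exists_residueField_hom
  obtain ⟨ζ, hζ⟩ := hσ z hz
  have h1 : ζ = σ (residue O τ) := by
    by_contra hne
    refine h.ne ?_
    have := (hζ (X - C τ)).2 (by simpa [sub_eq_zero] using hne)
    simpa using this
  rw [hζ, h1, eval₂_hom, Ne, map_eq_zero]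

/-- If the residue of `z` does not lie in the residue field of `O`, then the value of a primitive
polynomial of degree less than `p` at `z` is a unit. -/
lemma Valuation.Integers.valuation_aeval_eq_one {p : ℕ} [Fact p.Prime] [CharP L p]
    (hO : (v.comap (algebraMap E L)).Integers O) {z : L} (hz : v z = 1)
    (hzp : z ^ p ∈ Set.range (algebraMap E L))
    (hτ : ∀ τ : O, v (z - algebraMap O L τ) = 1) {H : O[X]} (hH : H.map (residue O) ≠ 0)
    (hdeg : (H.map (residue O)).natDegree < p) : v (aeval z H) = 1 := by
  obtain ⟨k, _, σ, hσ⟩ := hO.exists_residueField_hom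
  obtain ⟨ζ, hζ⟩ := hσ z hz.le
  let _ := σ.toAlgebra
  have hpk : (p : k) = 0 := by
    by_contra hne
    have := (hζ (C (p : O))).2 (by simpa using hne)
    simp at this
  have : CharP k p := (CharP.charP_iff_prime_eq_zero Fact.out).2 hpk
  obtain ⟨e, he⟩ := hzp
  obtain ⟨a, ha⟩ := hO.exists_of_le_one (r := e) (by rw [Valuation.comap_apply, he, map_pow, hz, one_pow])
  have h1 : ζ ^ p = σ (residue O a) := by
    by_contra hne
    have := (hζ (X ^ p - C a)).2 (by simpa [sub_eq_zero] using hne)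
    rw [_root_.map_sub, map_pow, aeval_X, aeval_C, IsScalarTower.algebraMap_apply O E L, ha, he,
      sub_self, map_zero] at this
    exact zero_ne_one this
  have h2 : ζ ∉ Set.range (algebraMap (ResidueField O) k) := by
    rintro ⟨t, ht⟩
    obtain ⟨τ, rfl⟩ := residue_surjective t
    have := (hζ (X - C τ)).1 (by simpa using hτ τ)
    refine this ?_
    simp only [Polynomial.map_sub, map_X, map_C, eval₂_sub, eval₂_X, eval₂_C, ← ht]
    exact sub_self _
  rw [hζ]
  exact aeval_ne_zero_of_natDegree_lt h2 ⟨_, h1.symm⟩ hH hdeg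

end Residue

section Residual

variable {p : ℕ} [Fact p.Prime] {E L Γ : Type*} [Field E] [Field L] [CharP L p]
  [LinearOrderedCommGroupWithZero Γ] [Algebra E L]
  {v : Valuation L Γ} {O : Type*} [CommRing O] [IsLocalRing O] [Algebra O E] [Algebra O L]
  [IsScalarTower O E L]

omit [IsLocalRing O] in
lemma Valuation.Integers.mul_aeval_mem_adjoin (hO : (v.comap (algebraMap E L)).Integers O)
    (z : L) (H : O[X]) {s : E} (hs : v (algebraMap E L s) ≤ 1) :
    algebraMap E L s * aeval z H ∈ Algebra.adjoin O {z} := by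
  obtain ⟨a, rfl⟩ := hO.exists_of_le_one hs
  rw [← IsScalarTower.algebraMap_apply]
  exact mul_mem (algebraMap_mem _ _) (aeval_mem_adjoin_singleton _ _)

omit [IsLocalRing O] in
lemma aeval_C_mul_map (z : L) (s : E) (H : O[X]) :
    aeval z (C s * H.map (algebraMap O E)) = algebraMap E L s * aeval z H := by
  simp

/-- An extension of degree `p` with a generator whose residue does not lie in the residue field of
`O` has a monogenic ring of integers. -/
lemma Valuation.Integers.mem_adjoin_of_residue_notMem (hfin : Module.finrank E L = p)
    (hO : (v.comap (algebraMap E L)).Integers O) {z : L} (hz : v z = 1)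
    (hzE : z ∉ Set.range (algebraMap E L)) (hzp : z ^ p ∈ Set.range (algebraMap E L))
    (hτ : ∀ τ : O, v (z - algebraMap O L τ) = 1) {w : L} (hw : v w ≤ 1) :
    w ∈ Algebra.adjoin O {z} := by
  obtain ⟨g, hg, rfl⟩ := exists_aeval_eq_of_notMem_range hfin hzE hzp w
  rcases eq_or_ne g 0 with rfl | hg0
  · simp
  obtain ⟨s, H, hs, rfl, hH⟩ := hO.exists_eq_C_mul_map hg0
  rw [natDegree_C_mul hs, natDegree_map_eq_of_injective hO.hom_inj] at hg
  have h1 := hO.valuation_aeval_eq_one hz hzp hτ hH (natDegree_map_le.trans_lt hg)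
  rw [aeval_C_mul_map] at hw ⊢
  rw [map_mul, h1, mul_one] at hw
  exact hO.mul_aeval_mem_adjoin z H hw

end Residual

section Ramified

variable {p : ℕ} [Fact p.Prime] {E L Γ : Type*} [Field E] [Field L]
  [LinearOrderedCommGroupWithZero Γ] [Algebra E L]
  {v : Valuation L Γ} {O : Type*} [CommRing O] [Algebra O E] [Algebra O L]
  [IsScalarTower O E L] {z : L}

/-- The monomials `b * z ^ i` with `b ≠ 0` and `i` prime to `p`. -/
def IsProperMonomial (p : ℕ) (E : Type*) {L : Type*} [Field E] [Field L] [Algebra E L]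
    (z m : L) : Prop :=
  ∃ (b : E) (i : ℕ), b ≠ 0 ∧ ¬ p ∣ i ∧ m = algebraMap E L b * z ^ i

lemma IsProperMonomial.mul_pow {x : L} (hx : IsProperMonomial p E z x) {c : E} (hc : c ≠ 0)
    {j : ℕ} (hj : ¬ p ∣ j) : IsProperMonomial p E z (algebraMap E L c * x ^ j) := by
  obtain ⟨b, i, hb, hi, rfl⟩ := hx
  refine ⟨c * b ^ j, i * j, mul_ne_zero hc (pow_ne_zero _ hb), ?_, ?_⟩
  · exact (Fact.out : p.Prime).prime.not_dvd_mul hi hj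
  · rw [map_mul, map_pow, _root_.mul_pow, pow_mul]; ring

lemma IsProperMonomial.exists_eq_mul_pow (hz0 : z ≠ 0) (hzp : z ^ p ∈ Set.range (algebraMap E L))
    {x m : L} (hx : IsProperMonomial p E z x) (hm : IsProperMonomial p E z m) :
    ∃ (c : E) (j : ℕ), c ≠ 0 ∧ 0 < j ∧ j < p ∧ m = algebraMap E L c * x ^ j := by
  have hp : p.Prime := Fact.out
  obtain ⟨e, he⟩ := hzp
  obtain ⟨b, i, hb, hi, rfl⟩ := hx
  obtain ⟨d, k, hd, hk, rfl⟩ := hm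
  have he0 : e ≠ 0 := by
    rintro rfl
    rw [map_zero] at he
    exact pow_ne_zero _ hz0 he.symm
  obtain ⟨j, hjp, hj⟩ : ∃ j < p, i * j ≡ k [MOD p] := by
    have hi' : (i : ZMod p) ≠ 0 := by rwa [Ne, ZMod.natCast_eq_zero_iff]
    refine ⟨((i : ZMod p)⁻¹ * k).val, ZMod.val_lt _, ?_⟩
    rw [← ZMod.natCast_eq_natCast_iff, Nat.cast_mul, ZMod.natCast_zmod_val, ← mul_assoc,
      mul_inv_cancel₀ hi', one_mul]
  obtain ⟨l, hl⟩ := (Nat.modEq_iff_dvd.1 hj)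
  have hbL : algebraMap E L b ≠ 0 := by simpa using hb
  have hj0 : 0 < j := by
    rw [Nat.pos_iff_ne_zero]
    rintro rfl
    exact hk ((Nat.modEq_zero_iff_dvd).1 (by simpa using hj.symm))
  refine ⟨d * (b ^ j)⁻¹ * e ^ l, j, ?_, hj0, hjp, ?_⟩
  · positivity
  · have h1 : z ^ k = z ^ (i * j) * algebraMap E L (e ^ l) := by
      rw [map_zpow₀, he, ← zpow_natCast z p, ← zpow_mul, ← hl, ← zpow_natCast z k,
        ← zpow_natCast z (i * j), ← zpow_add₀ hz0]
      congr 1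
      ring
    rw [h1, map_mul, map_mul, map_inv₀, map_pow, _root_.mul_pow, ← pow_mul]
    field_simp

lemma exists_lt_pow_le_and_not {Γ : Type*} [LinearOrderedCommGroupWithZero Γ] {x m : Γ}
    (hm : m ≤ 1) {j : ℕ} (hj : ¬ m ≤ x ^ j) : ∃ k < j, m ≤ x ^ k ∧ ¬ m ≤ x ^ (k + 1) := by
  induction j with
  | zero => exact absurd (by simpa using hm) hj
  | succ j ih =>
    by_cases h : m ≤ x ^ j
    · exact ⟨j, j.lt_succ_self, h, hj⟩
    · obtain ⟨k, hk, h⟩ := ih h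
      exact ⟨k, by omega, h⟩

omit [Fact p.Prime] in
lemma IsProperMonomial.ne_zero (hz0 : z ≠ 0) {x : L} (hx : IsProperMonomial p E z x) : x ≠ 0 := by
  obtain ⟨b, i, hb, hi, rfl⟩ := hx
  exact mul_ne_zero (by simpa using hb) (pow_ne_zero _ hz0)

lemma mem_adjoin_of_eq_mul_pow (hO : (v.comap (algebraMap E L)).Integers O) {x m : L} {c : E}
    {j : ℕ} (hx : x ≠ 0) (hm : m = algebraMap E L c * x ^ j) (hle : v m ≤ v x ^ j) :
    m ∈ Algebra.adjoin O {x} := by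
  have hc : v (algebraMap E L c) ≤ 1 := by
    rw [hm, map_mul, map_pow] at hle
    have : 0 < v x ^ j := pow_pos (v.pos_iff.2 hx) j
    exact (mul_le_iff_le_one_left this).1 hle
  obtain ⟨a, rfl⟩ := hO.exists_of_le_one hc
  rw [hm, ← IsScalarTower.algebraMap_apply]
  exact mul_mem (algebraMap_mem _ _) (pow_mem (Algebra.self_mem_adjoin_singleton _ _) _)

lemma exists_directed_properMonomials (hO : (v.comap (algebraMap E L)).Integers O)
    (hz0 : z ≠ 0) (hzp : z ^ p ∈ Set.range (algebraMap E L)) :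
    ∃ Q : Set L, Q.Nonempty ∧ (∀ x ∈ Q, IsProperMonomial p E z x ∧ v x ≤ 1) ∧
      ∀ x ∈ Q, ∀ m, IsProperMonomial p E z m → v m ≤ 1 →
        ∃ x' ∈ Q, x ∈ Algebra.adjoin O {x'} ∧ m ∈ Algebra.adjoin O {x'} := by
  have hp : p.Prime := Fact.out
  have hndvd : ∀ {j : ℕ}, 0 < j → j < p → ¬ p ∣ j := fun h0 h1 h ↦
    absurd (Nat.le_of_dvd h0 h) (not_le.2 h1)
  have hz : IsProperMonomial p E z z :=
    ⟨1, 1, one_ne_zero, hndvd one_pos hp.one_lt, by simp⟩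
  obtain ⟨e, he⟩ := hzp
  have he0 : e ≠ 0 := by
    rintro rfl
    rw [map_zero] at he
    exact pow_ne_zero _ hz0 he.symm
  have hne : ∃ x, IsProperMonomial p E z x ∧ v x ≤ 1 := by
    rcases le_total (v z) 1 with h | h
    · exact ⟨z, hz, h⟩
    · refine ⟨z⁻¹, ⟨e⁻¹, p - 1, inv_ne_zero he0,
        hndvd (Nat.sub_pos_of_lt hp.one_lt) (Nat.sub_lt hp.pos one_pos), ?_⟩, ?_⟩
      · rw [map_inv₀, he]
        have : z ^ p = z ^ (p - 1) * z := by rw [← pow_succ, Nat.sub_add_cancel hp.one_le]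
        rw [this]
        field_simp
      · rw [map_inv₀]
        exact inv_le_one_of_one_le₀ h
  have hrel := fun {x m : L} (hx : IsProperMonomial p E z x) (hm : IsProperMonomial p E z m) ↦
    hx.exists_eq_mul_pow hz0 ⟨e, he⟩ hm
  by_cases hsmall : ∀ x, IsProperMonomial p E z x → v x ≤ 1 →
      ∃ ρ, IsProperMonomial p E z ρ ∧ v ρ ≤ 1 ∧ v x ≤ v ρ ^ 2
  · have hiter : ∀ n : ℕ, ∀ x, IsProperMonomial p E z x → v x ≤ 1 →
        ∃ ρ, IsProperMonomial p E z ρ ∧ v ρ ≤ 1 ∧ v x ≤ v ρ ^ 2 ^ n := by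
      intro n
      induction n with
      | zero => exact fun x hx hx1 ↦ ⟨x, hx, hx1, by simp⟩
      | succ n ih =>
        intro x hx hx1
        obtain ⟨ρ, hρ, hρ1, h⟩ := ih x hx hx1
        obtain ⟨ρ', hρ', hρ1', h'⟩ := hsmall ρ hρ hρ1
        refine ⟨ρ', hρ', hρ1', h.trans ?_⟩
        rw [pow_succ', pow_mul]
        exact pow_le_pow_left₀ zero_le h' _
    refine ⟨{x | IsProperMonomial p E z x ∧ v x ≤ 1}, hne, fun x hx ↦ hx, ?_⟩
    rintro x ⟨hx, hx1⟩ m hm hm1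
    obtain ⟨ρ, hρ, hρ1, hxρ, hmρ⟩ : ∃ ρ, IsProperMonomial p E z ρ ∧ v ρ ≤ 1 ∧
        v x ≤ v ρ ^ p ∧ v m ≤ v ρ ^ p := by
      have hpow {ρ : L} (h : v ρ ≤ 1) : v ρ ^ 2 ^ p ≤ v ρ ^ p :=
        pow_le_pow_of_le_one zero_le h Nat.lt_two_pow_self.le
      rcases le_total (v x) (v m) with h | h
      · obtain ⟨ρ, hρ, hρ1, h'⟩ := hiter p m hm hm1
        exact ⟨ρ, hρ, hρ1, h.trans (h'.trans (hpow hρ1)), h'.trans (hpow hρ1)⟩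
      · obtain ⟨ρ, hρ, hρ1, h'⟩ := hiter p x hx hx1
        exact ⟨ρ, hρ, hρ1, h'.trans (hpow hρ1), h.trans (h'.trans (hpow hρ1))⟩
    refine ⟨ρ, ⟨hρ, hρ1⟩, ?_, ?_⟩
    · obtain ⟨c, j, -, -, hj, h⟩ := hrel hρ hx
      exact mem_adjoin_of_eq_mul_pow hO (hρ.ne_zero hz0) h
        (hxρ.trans (pow_le_pow_of_le_one zero_le hρ1 hj.le))
    · obtain ⟨c, j, -, -, hj, h⟩ := hrel hρ hm
      exact mem_adjoin_of_eq_mul_pow hO (hρ.ne_zero hz0) h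
        (hmρ.trans (pow_le_pow_of_le_one zero_le hρ1 hj.le))
  · push Not at hsmall
    obtain ⟨x₀, hx₀, hx₀1, hbig⟩ := hsmall
    refine ⟨{x | (IsProperMonomial p E z x ∧ v x ≤ 1) ∧ v x₀ ≤ v x}, ⟨x₀, ⟨hx₀, hx₀1⟩, le_rfl⟩,
      fun x hx ↦ hx.1, ?_⟩
    rintro x ⟨⟨hx, hx1⟩, hx₀x⟩ m hm hm1
    obtain ⟨c, j, hc, hj0, hjp, hcj⟩ := hrel hx hm
    have hxne := hx.ne_zero hz0
    have hxpos : 0 < v x := v.pos_iff.2 hxne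
    by_cases hle : v m ≤ v x ^ j
    · exact ⟨x, ⟨⟨hx, hx1⟩, hx₀x⟩, Algebra.self_mem_adjoin_singleton _ _,
        mem_adjoin_of_eq_mul_pow hO hxne hcj hle⟩
    obtain ⟨k, hkj, hk, hk'⟩ := exists_lt_pow_le_and_not hm1 hle
    have hρeq : m = (algebraMap E L c * x ^ (j - k)) * x ^ k := by
      rw [mul_assoc, ← pow_add, Nat.sub_add_cancel hkj.le, hcj]
    have hρ := hx.mul_pow hc (hndvd (Nat.sub_pos_of_lt hkj) ((Nat.sub_le j k).trans_lt hjp))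
    set ρ := algebraMap E L c * x ^ (j - k) with hρdef
    have hvm : v m = v ρ * v x ^ k := by rw [hρeq, map_mul, map_pow]
    have hρ1 : v ρ ≤ 1 := by
      rw [hvm] at hk
      exact (mul_le_iff_le_one_left (pow_pos hxpos k)).1 hk
    have hxρ : v x < v ρ := by
      rw [hvm, pow_succ', not_le] at hk'
      exact lt_of_mul_lt_mul_right' hk'
    have hρne := hρ.ne_zero hz0
    obtain ⟨d, i, hd, hi0, hip, hdi⟩ := hrel hρ hx
    by_cases hle' : v x ≤ v ρ ^ i
    · have hmem := mem_adjoin_of_eq_mul_pow hO hρne hdi hle'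
      refine ⟨ρ, ⟨⟨hρ, hρ1⟩, hx₀x.trans hxρ.le⟩, hmem, ?_⟩
      rw [hρeq]
      exact mul_mem (Algebra.self_mem_adjoin_singleton _ _) (pow_mem hmem k)
    exfalso
    have hi1 : i ≠ 1 := by
      rintro rfl
      exact hle' (by simpa using hxρ.le)
    have hσ := hρ.mul_pow hd (j := i - 1) (hndvd (by omega) (by omega))
    have hσeq : x = (algebraMap E L d * ρ ^ (i - 1)) * ρ := by
      rw [mul_assoc, ← pow_succ, Nat.sub_add_cancel hi0, ← hdi]
    set σ := algebraMap E L d * ρ ^ (i - 1)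
    have hvx : v x = v σ * v ρ := by rw [hσeq, map_mul]
    have hρpos : 0 < v ρ := v.pos_iff.2 hρne
    have hσ1 : v σ ≤ 1 := by
      rw [hvx] at hxρ
      exact ((mul_lt_iff_lt_one_left hρpos).1 hxρ).le
    have h1 := (hbig ρ hρ hρ1).trans_le hx₀x
    have h2 := (hbig σ hσ hσ1).trans_le hx₀x
    rw [hvx, sq] at h1 h2
    exact lt_asymm (lt_of_mul_lt_mul_right' h1) (lt_of_mul_lt_mul_left' h2)

end Ramified

section RamifiedStep

variable {p : ℕ} [Fact p.Prime] {E L Γ : Type*} [Field E] [Field L] [CharP L p]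
  [LinearOrderedCommGroupWithZero Γ] [Algebra E L]
  {v : Valuation L Γ} {O : Type*} [CommRing O] [Algebra O E] [Algebra O L]
  [IsScalarTower O E L] {z : L}

omit [CharP L p] in
lemma IsProperMonomial.valuation_ne (hz0 : z ≠ 0) (hzp : z ^ p ∈ Set.range (algebraMap E L))
    (hz : ∀ e, v (algebraMap E L e) ≠ v z) {x : L} (hx : IsProperMonomial p E z x) (e : E) :
    v (algebraMap E L e) ≠ v x := by
  intro h
  have hp : p.Prime := Fact.out
  obtain ⟨c, j, -, -, -, hj⟩ := hx.exists_eq_mul_pow hz0 hzp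
    (m := z) ⟨1, 1, one_ne_zero, hp.one_lt.ne' ∘ Nat.dvd_one.1, by simp⟩
  refine hz (c * e ^ j) ?_
  rw [hj, map_mul, map_mul, map_mul, map_pow, map_pow, map_pow, h]

omit [CharP L p] in
lemma valuation_monomial_ne (hz0 : z ≠ 0) (hzp : z ^ p ∈ Set.range (algebraMap E L))
    (hz : ∀ e, v (algebraMap E L e) ≠ v z) {b c : E} (hb : b ≠ 0) (hc : c ≠ 0) {i j : ℕ}
    (hij : i < j) (hj : j < p) :
    v (algebraMap E L b * z ^ i) ≠ v (algebraMap E L c * z ^ j) := by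
  intro h
  have hx : IsProperMonomial p E z (algebraMap E L (b⁻¹ * c) * z ^ (j - i)) :=
    ⟨b⁻¹ * c, j - i, mul_ne_zero (inv_ne_zero hb) hc,
      fun h ↦ absurd (Nat.le_of_dvd (by omega) h) (by omega), rfl⟩
  refine hx.valuation_ne hz0 hzp hz 1 ?_
  have hbv : v (algebraMap E L b) ≠ 0 := by simpa using hb
  have hzv : v z ≠ 0 := by simpa using hz0
  have h1 : z ^ j = z ^ (j - i) * z ^ i := by rw [← pow_add, Nat.sub_add_cancel hij.le]
  rw [h1] at h
  simp only [map_mul, map_pow, map_one, map_inv₀] at h ⊢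
  have h2 : v (algebraMap E L b) * v z ^ i =
      v (algebraMap E L c) * v z ^ (j - i) * v z ^ i := by rw [h, mul_assoc]
  have h3 := mul_right_cancel₀ (pow_ne_zero i hzv) h2
  rw [mul_assoc, ← h3, inv_mul_cancel₀ hbv]

omit [CharP L p] in
lemma valuation_monomial_le_one (hz0 : z ≠ 0) (hzp : z ^ p ∈ Set.range (algebraMap E L))
    (hz : ∀ e, v (algebraMap E L e) ≠ v z) {g : E[X]} (hg : g.natDegree < p)
    (hw : v (aeval z g) ≤ 1) (i : ℕ) : v (algebraMap E L (g.coeff i) * z ^ i) ≤ 1 := by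
  by_contra! hi
  have hsupp : ∀ {j}, 1 < v (algebraMap E L (g.coeff j) * z ^ j) → j ∈ g.support := by
    intro j hj
    rw [mem_support_iff]
    intro h0
    simp [h0] at hj
  obtain ⟨k, hk, hmax⟩ := g.support.exists_max_image
    (fun i ↦ v (algebraMap E L (g.coeff i) * z ^ i)) ⟨i, hsupp hi⟩
  have hdeg {j : ℕ} (hj : j ∈ g.support) : j < p := (le_natDegree_of_mem_supp j hj).trans_lt hg
  refine (lt_of_lt_of_le hi (hmax i (hsupp hi))).not_ge (le_of_eq_of_le ?_ hw)
  rw [aeval_eq_sum_range' (Nat.lt_succ_self _), ← Finset.sum_subset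
    (s₁ := g.support)]
  · simp only [Algebra.smul_def]
    rw [v.map_sum_eq_of_lt hk]
    intro j hj
    obtain ⟨hj, hjk⟩ := Finset.mem_sdiff.1 hj
    rw [Finset.mem_singleton] at hjk
    refine lt_of_le_of_ne (hmax j hj) ?_
    rcases lt_or_gt_of_ne hjk with h | h
    · exact valuation_monomial_ne hz0 hzp hz (mem_support_iff.1 hj) (mem_support_iff.1 hk) h
        (hdeg hk)
    · exact (valuation_monomial_ne hz0 hzp hz (mem_support_iff.1 hk) (mem_support_iff.1 hj) h
        (hdeg hj)).symm
  · exact fun j hj ↦ Finset.mem_range.2 (Nat.lt_succ_of_le (le_natDegree_of_mem_supp j hj))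
  · intro j _ hj
    rw [notMem_support_iff.1 hj, zero_smul]

lemma Valuation.Integers.exists_subset_adjoin_of_valuation_notMem
    (hfin : Module.finrank E L = p) (hO : (v.comap (algebraMap E L)).Integers O)
    (hz0 : z ≠ 0) (hzp : z ^ p ∈ Set.range (algebraMap E L))
    (hz : ∀ e, v (algebraMap E L e) ≠ v z) (S : Finset L) (hS : ∀ s ∈ S, v s ≤ 1) :
    ∃ x, v x ≤ 1 ∧ x ∉ Set.range (algebraMap E L) ∧ ∀ s ∈ S, s ∈ Algebra.adjoin O {x} := by
  classical
  have hzE : z ∉ Set.range (algebraMap E L) := by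
    rintro ⟨e, rfl⟩
    exact hz e rfl
  obtain ⟨Q, hQne, hQ, hdir⟩ := exists_directed_properMonomials hO hz0 hzp
  have htrans {x x' w : L} (h : x ∈ Algebra.adjoin O {x'}) (hw : w ∈ Algebra.adjoin O {x}) :
      w ∈ Algebra.adjoin O {x'} :=
    Algebra.adjoin_le (Set.singleton_subset_iff.2 h) hw
  have hgen : ∀ w ∈ Algebra.adjoin O {m | IsProperMonomial p E z m ∧ v m ≤ 1}, ∀ x ∈ Q,
      ∃ x' ∈ Q, x ∈ Algebra.adjoin O {x'} ∧ w ∈ Algebra.adjoin O {x'} := by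
    intro w hw
    induction hw using Algebra.adjoin_induction with
    | mem m hm => exact fun x hx ↦ hdir x hx m hm.1 hm.2
    | algebraMap a => exact fun x hx ↦
        ⟨x, hx, Algebra.self_mem_adjoin_singleton _ _, algebraMap_mem _ _⟩
    | add w₁ w₂ _ _ ih₁ ih₂ =>
      intro x hx
      obtain ⟨x₁, hx₁, h₁, hw₁⟩ := ih₁ x hx
      obtain ⟨x₂, hx₂, h₂, hw₂⟩ := ih₂ x₁ hx₁
      exact ⟨x₂, hx₂, htrans h₂ h₁, add_mem (htrans h₂ hw₁) hw₂⟩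
    | mul w₁ w₂ _ _ ih₁ ih₂ =>
      intro x hx
      obtain ⟨x₁, hx₁, h₁, hw₁⟩ := ih₁ x hx
      obtain ⟨x₂, hx₂, h₂, hw₂⟩ := ih₂ x₁ hx₁
      exact ⟨x₂, hx₂, htrans h₂ h₁, mul_mem (htrans h₂ hw₁) hw₂⟩
  have hmono : ∀ w, v w ≤ 1 → w ∈ Algebra.adjoin O {m | IsProperMonomial p E z m ∧ v m ≤ 1} := by
    intro w hw
    obtain ⟨g, hg, rfl⟩ := exists_aeval_eq_of_notMem_range hfin hzE hzp w
    have hle := valuation_monomial_le_one hz0 hzp hz hg hw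
    rw [aeval_eq_sum_range]
    refine sum_mem fun i hi ↦ ?_
    rw [Algebra.smul_def]
    rcases eq_or_ne (g.coeff i) 0 with h0 | h0
    · simp [h0]
    rcases Nat.eq_zero_or_pos i with rfl | hi0
    · have := hle 0
      rw [pow_zero, mul_one] at this ⊢
      obtain ⟨a, ha⟩ := hO.exists_of_le_one this
      rw [← ha, ← IsScalarTower.algebraMap_apply]
      exact algebraMap_mem _ _
    · refine Algebra.subset_adjoin ⟨⟨_, i, h0, fun h ↦ ?_, rfl⟩, hle i⟩
      have := Nat.le_of_dvd hi0 h
      have := Finset.mem_range.1 hi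
      omega
  have hfinset : ∃ x ∈ Q, ∀ s ∈ S, s ∈ Algebra.adjoin O {x} := by
    induction S using Finset.induction_on with
    | empty =>
      obtain ⟨x, hx⟩ := hQne
      exact ⟨x, hx, by simp⟩
    | insert s S _ ih =>
      obtain ⟨x, hx, h⟩ := ih fun s hs ↦ hS s (Finset.mem_insert_of_mem hs)
      obtain ⟨x', hx', h1, h2⟩ := hgen s (hmono s (hS s (Finset.mem_insert_self _ _))) x hx
      refine ⟨x', hx', fun t ht ↦ ?_⟩
      rcases Finset.mem_insert.1 ht with rfl | ht
      · exact h2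
      · exact htrans h1 (h t ht)
  obtain ⟨x, hx, h⟩ := hfinset
  refine ⟨x, (hQ x hx).2, ?_, h⟩
  rintro ⟨e, he⟩
  exact (hQ x hx).1.valuation_ne hz0 hzp hz e (by rw [he])

end RamifiedStep

section Immediate

variable {E L Γ : Type*} [Field E] [Field L]
  [LinearOrderedCommGroupWithZero Γ] [Algebra E L]
  {v : Valuation L Γ} {O : Type*} [CommRing O] [IsLocalRing O] [Algebra O E] [Algebra O L]
  [IsScalarTower O E L] {y : L}

/-- `P a` holds for all `a ∈ E` sufficiently close to `y`. -/
def NearTo (v : Valuation L Γ) (y : L) (P : E → Prop) : Prop :=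
  ∃ a₀ : E, ∀ a, v (y - algebraMap E L a) < v (y - algebraMap E L a₀) → P a

lemma NearTo.mono {P Q : E → Prop} (hP : NearTo v y P) (h : ∀ a, P a → Q a) : NearTo v y Q := by
  obtain ⟨a₀, h₀⟩ := hP
  exact ⟨a₀, fun a ha ↦ h a (h₀ a ha)⟩

lemma NearTo.and {P Q : E → Prop} (hP : NearTo v y P) (hQ : NearTo v y Q) :
    NearTo v y fun a ↦ P a ∧ Q a := by
  obtain ⟨a₀, h₀⟩ := hP
  obtain ⟨a₁, h₁⟩ := hQ
  rcases le_total (v (y - algebraMap E L a₀)) (v (y - algebraMap E L a₁)) with h | h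
  · exact ⟨a₀, fun a ha ↦ ⟨h₀ a ha, h₁ a (ha.trans_le h)⟩⟩
  · exact ⟨a₁, fun a ha ↦ ⟨h₀ a (ha.trans_le h), h₁ a ha⟩⟩

lemma NearTo.forall_finset {ι : Type*} {P : ι → E → Prop} (S : Finset ι)
    (h : ∀ s ∈ S, NearTo v y (P s)) : NearTo v y fun a ↦ ∀ s ∈ S, P s a := by
  classical
  induction S using Finset.induction_on with
  | empty => exact ⟨0, by simp⟩
  | insert s S _ ih =>
    refine ((h s (Finset.mem_insert_self _ _)).and
      (ih fun t ht ↦ h t (Finset.mem_insert_of_mem ht))).mono fun a ha t ht ↦ ?_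
    rcases Finset.mem_insert.1 ht with rfl | ht
    · exact ha.1
    · exact ha.2 t ht

/-- `b` has the same value as `y - a`. -/
def IsScale (v : Valuation L Γ) (y : L) (a b : E) : Prop :=
  b ≠ 0 ∧ v (y - algebraMap E L a) = v (algebraMap E L b)

variable (O) in
/-- The content `s` and the primitive part `H` of the polynomial `g (a + b X)`. -/
def IsNormalization (g : E[X]) (a b s : E) (H : O[X]) : Prop :=
  s ≠ 0 ∧ g.comp (C a + C b * X) = C s * H.map (algebraMap O E) ∧ H.map (residue O) ≠ 0

omit [IsLocalRing O] in
lemma IsScale.aeval_eq {a b : E} (hab : IsScale v y a b) {g : E[X]} {s : E} {H : O[X]}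
    (h : g.comp (C a + C b * X) = C s * H.map (algebraMap O E)) :
    aeval y g = algebraMap E L s * aeval ((y - algebraMap E L a) / algebraMap E L b) H := by
  have hb : algebraMap E L b ≠ 0 := by simpa using hab.1
  rw [← aeval_C_mul_map, ← h, aeval_comp]
  congr 2
  simp only [map_add, map_mul, aeval_C, aeval_X]
  field_simp
  ring

omit [Algebra O L] [IsScalarTower O E L] in
lemma exists_isNormalization (hO : (v.comap (algebraMap E L)).Integers O) {g : E[X]} (hg : g ≠ 0)
    (a : E) {b : E} (hb : b ≠ 0) : ∃ s H, IsNormalization O g a b s H := by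
  refine hO.exists_eq_C_mul_map fun h ↦ hg ?_
  rcases comp_eq_zero_iff.1 h with h | ⟨-, h⟩
  · exact h
  · have := congr_arg (coeff · 1) h
    simp [hb, coeff_C] at this

/-- `g` is good if the value of `g (y)` is the content of `g (a + b X)` for some scale `b`
of `y - a`. -/
def IsGood (O : Type*) [CommRing O] [IsLocalRing O] [Algebra O E] [Algebra O L]
    (v : Valuation L Γ) (y : L) (g : E[X]) : Prop :=
  ∃ (a b s : E) (H : O[X]), IsScale v y a b ∧ IsNormalization O g a b s H ∧
    v (aeval ((y - algebraMap E L a) / algebraMap E L b) H) = 1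

lemma IsGood.nearTo (hO : (v.comap (algebraMap E L)).Integers O) {g : E[X]}
    (hg : IsGood O v y g) :
    NearTo v y fun a ↦ ∀ b, IsScale v y a b → ∃ (s : E) (H : O[X]) (c : ResidueField O),
      IsNormalization O g a b s H ∧ H.map (residue O) = C c ∧ c ≠ 0 := by
  obtain ⟨a, b, s, H, hab, ⟨hs, hH, hH0⟩, hgood⟩ := hg
  refine ⟨a, fun a₁ ha₁ b₁ hab₁ ↦ ?_⟩
  have hbL : algebraMap E L b ≠ 0 := by simpa using hab.1
  have hbv : 0 < v (algebraMap E L b) := v.pos_iff.2 hbL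
  have hdist : v (algebraMap E L (a₁ - a)) = v (algebraMap E L b) := by
    rw [← hab.2, ← v.map_sub_eq_of_lt_left ha₁]
    congr 1
    rw [_root_.map_sub]; ring
  obtain ⟨u, hu⟩ := hO.exists_of_le_one (r := (a₁ - a) / b) (by
    rw [Valuation.comap_apply, map_div₀, map_div₀, hdist, div_self hbv.ne'])
  have hβ' : v (algebraMap E L (b₁ / b)) < 1 := by
    rw [map_div₀, map_div₀, ← hab₁.2, div_lt_one₀ hbv, ← hab.2]
    exact ha₁
  obtain ⟨β, hβ⟩ := hO.exists_of_le_one (r := b₁ / b) hβ'.le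
  have hβ0 : residue O β = 0 := by
    by_contra h
    rw [← Ne, hO.residue_ne_zero_iff, hβ] at h
    exact hβ'.ne h
  have hmap : (H.comp (C u + C β * X)).map (residue O) =
      C ((H.map (residue O)).eval (residue O u)) := by
    simp [Polynomial.map_comp, hβ0]
  have hne : (H.map (residue O)).eval (residue O u) ≠ 0 := by
    refine (hO.valuation_aeval_eq_one_iff ?_ H).1 hgood
    rw [IsScalarTower.algebraMap_apply O E L, hu, map_div₀, ← sub_div, map_div₀,
      div_lt_one₀ hbv, ← hab.2]
    refine lt_of_eq_of_lt ?_ ha₁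
    congr 1
    rw [_root_.map_sub]; ring
  refine ⟨s, H.comp (C u + C β * X), _, ⟨hs, ?_, ?_⟩, hmap, hne⟩
  · have hb := hab.1
    have h1 : (C a + C b * X : E[X]).comp (C ((a₁ - a) / b) + C (b₁ / b) * X) =
        C a₁ + C b₁ * X := by
      simp only [add_comp, C_comp, mul_comp, X_comp, mul_add, ← mul_assoc, ← C_mul]
      rw [mul_div_cancel₀ _ hb, mul_div_cancel₀ _ hb, ← add_assoc, ← C_add, add_sub_cancel]
    rw [← h1, ← comp_assoc, hH, Polynomial.map_comp]
    simp [hu, hβ]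
  · rw [hmap]
    simpa using hne

/-- A polynomial that is not good has non-constant reductions. -/
lemma natDegree_pos_of_not_isGood (hO : (v.comap (algebraMap E L)).Integers O) {g : E[X]}
    (hg : ¬ IsGood O v y g) {a b s : E} {H : O[X]} (hab : IsScale v y a b)
    (hH : IsNormalization O g a b s H)
    {τ : O} (hτ : v ((y - algebraMap E L a) / algebraMap E L b - algebraMap O L τ) < 1) :
    0 < (H.map (residue O)).natDegree := by
  rw [Nat.pos_iff_ne_zero]
  intro h0
  refine hg ⟨a, b, s, H, hab, hH, ?_⟩
  rw [hO.valuation_aeval_eq_one_iff hτ, eq_C_of_natDegree_eq_zero h0, eval_C]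
  intro hc
  exact hH.2.2 (by rw [eq_C_of_natDegree_eq_zero h0, hc, C_0])

lemma isGood_of_natDegree_le_one (hO : (v.comap (algebraMap E L)).Integers O)
    (hscale : ∀ a : E, ∃ b, IsScale v y a b)
    (hnear : ∀ a : E, ∃ a', v (y - algebraMap E L a') < v (y - algebraMap E L a))
    {g : E[X]} (hg : g ≠ 0) (hdeg : g.natDegree ≤ 1) : IsGood O v y g := by
  obtain ⟨l, m, rfl⟩ := exists_eq_X_add_C_of_natDegree_le_one hdeg
  rcases eq_or_ne l 0 with rfl | hl
  · obtain ⟨b, hab⟩ := hscale 0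
    refine ⟨0, b, m, 1, hab, ⟨?_, ?_, ?_⟩, ?_⟩
    · rintro rfl
      simp at hg
    · simp
    · simp
    · simp
  obtain ⟨a, ha⟩ := hnear (-m / l)
  obtain ⟨b, hab⟩ := hscale a
  have hdist : v (algebraMap E L (a - -m / l)) = v (y - algebraMap E L (-m / l)) := by
    rw [← v.map_sub_eq_of_lt_left ha]
    congr 1
    rw [_root_.map_sub]; ring
  have hpos : 0 < v (y - algebraMap E L (-m / l)) := zero_le.trans_lt ha
  have hne : a - -m / l ≠ 0 := by
    intro h
    rw [h, map_zero, map_zero] at hdist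
    exact hpos.ne hdist
  have hβ' : v (algebraMap E L (b / (a - -m / l))) < 1 := by
    rw [map_div₀, map_div₀, ← hab.2, hdist, div_lt_one₀ hpos]
    exact ha
  obtain ⟨β, hβ⟩ := hO.exists_of_le_one (r := b / (a - -m / l)) hβ'.le
  have hβ0 : residue O β = 0 := by
    by_contra h
    rw [← Ne, hO.residue_ne_zero_iff, hβ] at h
    exact hβ'.ne h
  refine ⟨a, b, l * (a - -m / l), 1 + C β * X, hab, ⟨mul_ne_zero hl hne, ?_, ?_⟩, ?_⟩
  · simp only [add_comp, mul_comp, C_comp, X_comp, Polynomial.map_add, Polynomial.map_one,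
      Polynomial.map_mul, map_C, map_X, hβ]
    have h1 : l * (a - -m / l) * (b / (a - -m / l)) = l * b := by
      rw [mul_assoc, mul_div_cancel₀ _ hne]
    have h2 : l * (a - -m / l) = l * a + m := by field_simp; ring
    rw [mul_add (C (_ * (_ - _))), mul_one, ← mul_assoc (C (_ * (_ - _))),
      ← C_mul (a := l * (a - -m / l)), h1, h2]
    simp only [C_add, C_mul]
    ring
  · simp [hβ0]
  · simp only [map_add, map_one, map_mul, aeval_C, aeval_X]
    refine v.map_one_add_of_lt ?_
    rw [map_mul, map_div₀, hab.2, div_self, mul_one, IsScalarTower.algebraMap_apply O E L, hβ]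
    · exact hβ'
    · simpa using hab.1

end Immediate

section ImmediateStep

variable {E L Γ : Type*} [Field E] [Field L]
  [LinearOrderedCommGroupWithZero Γ] [Algebra E L]
  {v : Valuation L Γ} {O : Type*} [CommRing O] [IsLocalRing O] [Algebra O E] [Algebra O L]
  [IsScalarTower O E L] {y : L}

omit [Algebra O L] [IsScalarTower O E L] in
lemma IsNormalization.natDegree_le {g : E[X]} {a b s : E} {H : O[X]}
    (hO : (v.comap (algebraMap E L)).Integers O) (h : IsNormalization O g a b s H) :
    H.natDegree ≤ g.natDegree := by
  have h1 : (C s * H.map (algebraMap O E)).natDegree = H.natDegree := by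
    rw [natDegree_C_mul h.1, natDegree_map_eq_of_injective hO.hom_inj]
  rw [← h1, ← h.2.1]
  refine natDegree_comp_le.trans ?_
  refine (Nat.mul_le_mul_left (m := 1) _ ?_).trans_eq (mul_one _)
  rw [add_comm]
  exact natDegree_linear_le

/-- If `g` has minimal degree among the polynomials which are not good, then the reductions of all
polynomials are polynomials in the reductions of `g`. -/
lemma nearTo_exists_comp (hO : (v.comap (algebraMap E L)).Integers O)
    (hred : ∀ a b : E, IsScale v y a b →
      ∃ τ : O, v ((y - algebraMap E L a) / algebraMap E L b - algebraMap O L τ) < 1)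
    {g : E[X]} (hg0 : 0 < g.natDegree) (hg : ¬ IsGood O v y g)
    (hmin : ∀ f : E[X], f ≠ 0 → f.natDegree < g.natDegree → IsGood O v y f)
    {f : E[X]} (hf : f ≠ 0) :
    NearTo v y fun a ↦ ∀ b, IsScale v y a b → ∀ t G, IsNormalization O g a b t G →
      ∃ (s : E) (H : O[X]) (P : (ResidueField O)[X]), IsNormalization O f a b s H ∧
        H.map (residue O) = P.comp (G.map (residue O)) ∧
        P.natDegree * g.natDegree ≤ f.natDegree := by
  induction hn : f.natDegree using Nat.strong_induction_on generalizing f with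
  | _ n ih =>
  subst hn
  rcases lt_or_ge f.natDegree g.natDegree with hlt | hge
  · refine ((hmin f hf hlt).nearTo hO).mono fun a ha b hab t G hG ↦ ?_
    obtain ⟨s, H, c, hH, hHc, hc⟩ := ha b hab
    exact ⟨s, H, C c, hH, by rw [hHc, C_comp], by simp⟩
  have hgne : g ≠ 0 := ne_zero_of_natDegree_gt hg0
  have hq0 : f / g ≠ 0 := by
    rw [Ne, Polynomial.div_eq_zero_iff hgne, not_lt, degree_eq_natDegree hgne, degree_eq_natDegree hf]
    exact_mod_cast hge
  have hfq : f = g * (f / g) + f % g := (EuclideanDomain.div_add_mod f g).symm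
  have hqdeg : (f / g).natDegree + g.natDegree = f.natDegree := by
    have h1 := degree_add_div hgne (p := f) (by
      rw [degree_eq_natDegree hgne, degree_eq_natDegree hf]; exact_mod_cast hge)
    rw [degree_eq_natDegree hgne, degree_eq_natDegree hf, degree_eq_natDegree hq0, add_comm] at h1
    exact_mod_cast h1
  have hr : NearTo v y fun a ↦ ∀ b, IsScale v y a b → ∃ (s : E) (H : O[X])
      (c : ResidueField O), (f % g).comp (C a + C b * X) = C s * H.map (algebraMap O E) ∧
      H.map (residue O) = C c ∧ c ≠ 0 := by
    rcases eq_or_ne (f % g) 0 with h0 | h0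
    · exact ⟨0, fun a _ b _ ↦ ⟨0, 1, 1, by simp [h0], by simp, one_ne_zero⟩⟩
    · have hlt : (f % g).natDegree < g.natDegree :=
        natDegree_lt_natDegree h0 (degree_mod_lt f hgne)
      refine ((hmin _ h0 hlt).nearTo hO).mono fun a ha b hab ↦ ?_
      obtain ⟨s, H, c, hH, hHc, hc⟩ := ha b hab
      exact ⟨s, H, c, hH.2.1, hHc, hc⟩
  refine ((ih _ (by omega) hq0 rfl).and hr).mono fun a ⟨haq, har⟩ b hab t G hG ↦ ?_
  obtain ⟨s₁, H₁, P, hH₁, hHP, hPdeg⟩ := haq b hab t G hG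
  obtain ⟨s₂, H₂, c, hH₂, hHc, hc⟩ := har b hab
  have hs : s₁ * t ≠ 0 := mul_ne_zero hH₁.1 hG.1
  have hsv : 0 < v (algebraMap E L (s₁ * t)) := v.pos_iff.2 (by simpa using hs)
  have hcomp : f.comp (C a + C b * X) = C (s₁ * t) * (H₁ * G).map (algebraMap O E) +
      C s₂ * H₂.map (algebraMap O E) := by
    conv_lhs => rw [hfq]
    rw [add_comp, mul_comp, hG.2.1, hH₁.2.1, hH₂, Polynomial.map_mul, C_mul]
    ring
  obtain ⟨τ, hτ⟩ := hred a b hab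
  have hGpos := natDegree_pos_of_not_isGood hO hg hab hG hτ
  by_cases hle : v (algebraMap E L s₂) ≤ v (algebraMap E L (s₁ * t))
  · obtain ⟨ρ, hρ⟩ := hO.exists_of_le_one (r := s₂ / (s₁ * t)) (by
      rw [Valuation.comap_apply, map_div₀, map_div₀]
      exact div_le_one_of_le₀ hle zero_le)
    have hmap : (H₁ * G + C ρ * H₂).map (residue O) =
        (P * X + C (residue O ρ * c)).comp (G.map (residue O)) := by
      simp [hHP, hHc]
    have hPne : P ≠ 0 := by
      rintro rfl
      exact hH₁.2.2 (by rw [hHP, zero_comp])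
    have hdeg : (P * X + C (residue O ρ * c)).natDegree = P.natDegree + 1 := by
      rw [natDegree_add_C, natDegree_mul_X hPne]
    refine ⟨s₁ * t, H₁ * G + C ρ * H₂, P * X + C (residue O ρ * c), ⟨hs, ?_, ?_⟩, hmap, ?_⟩
    · rw [hcomp, Polynomial.map_add, mul_add, Polynomial.map_mul (f := algebraMap O E) (p := C ρ),
        map_C, hρ, ← mul_assoc (C (s₁ * t)) (C _), ← C_mul, mul_div_cancel₀ _ hs]
    · rw [hmap]
      intro h0
      rcases comp_eq_zero_iff.1 h0 with h | ⟨-, h⟩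
      · rw [h, natDegree_zero] at hdeg
        omega
      · rw [h, natDegree_C] at hGpos
        omega
    · rw [hdeg, add_mul, one_mul]
      omega
  · rw [not_le] at hle
    have hs₂v : 0 < v (algebraMap E L s₂) := zero_le.trans_lt hle
    have hs₂ : s₂ ≠ 0 := by
      rintro rfl
      simp at hs₂v
    have hρ' : v (algebraMap E L (s₁ * t / s₂)) < 1 := by
      rwa [map_div₀, map_div₀, div_lt_one₀ hs₂v]
    obtain ⟨ρ, hρ⟩ := hO.exists_of_le_one (r := s₁ * t / s₂) hρ'.le
    have hρ0 : residue O ρ = 0 := by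
      by_contra h
      rw [← Ne, hO.residue_ne_zero_iff, hρ] at h
      exact hρ'.ne h
    have hmap : (C ρ * (H₁ * G) + H₂).map (residue O) = C c := by
      simp [hρ0, hHc]
    refine ⟨s₂, C ρ * (H₁ * G) + H₂, C c, ⟨hs₂, ?_, ?_⟩, by rw [hmap, C_comp], by simp⟩
    · rw [hcomp, Polynomial.map_add, mul_add, Polynomial.map_mul (f := algebraMap O E) (p := C ρ),
        map_C, hρ, ← mul_assoc (C s₂) (C _), ← C_mul, mul_div_cancel₀ _ hs₂]
    · rw [hmap]
      simpa using hc

variable {p : ℕ} [Fact p.Prime] [CharP L p]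

lemma isGood_of_natDegree_lt (hO : (v.comap (algebraMap E L)).Integers O)
    (hyp : y ^ p ∈ Set.range (algebraMap E L))
    (hscale : ∀ a : E, ∃ b, IsScale v y a b)
    (hnear : ∀ a : E, ∃ a', v (y - algebraMap E L a') < v (y - algebraMap E L a))
    (hred : ∀ a b : E, IsScale v y a b →
      ∃ τ : O, v ((y - algebraMap E L a) / algebraMap E L b - algebraMap O L τ) < 1)
    {g : E[X]} (hg : g ≠ 0) (hgp : g.natDegree < p) : IsGood O v y g := by
  have hp : p.Prime := Fact.out
  induction hn : g.natDegree using Nat.strong_induction_on generalizing g with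
  | _ n ih =>
  subst hn
  by_contra hbad
  have hdeg2 : 1 < g.natDegree := by
    by_contra! h
    exact hbad (isGood_of_natDegree_le_one hO hscale hnear hg h)
  have hmin : ∀ f : E[X], f ≠ 0 → f.natDegree < g.natDegree → IsGood O v y f :=
    fun f hf hfg ↦ ih _ hfg hf (hfg.trans hgp) rfl
  obtain ⟨e, he⟩ := hyp
  have hEp : CharP E p := (RingHom.charP_iff (algebraMap E L) (algebraMap E L).injective p).2 ‹_›
  obtain ⟨a₀, ha₀⟩ := nearTo_exists_comp hO hred (by omega) hbad hmin
    (f := X ^ p - C e) (X_pow_sub_C_ne_zero hp.pos e)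
  obtain ⟨a, ha⟩ := hnear a₀
  obtain ⟨b, hab⟩ := hscale a
  obtain ⟨t, G, hG⟩ := exists_isNormalization hO hg a hab.1
  obtain ⟨τ, hτ⟩ := hred a b hab
  have hGpos := natDegree_pos_of_not_isGood hO hbad hab hG hτ
  obtain ⟨s, H, P, hH, hHP, hPdeg⟩ := ha₀ a ha b hab t G hG
  have hbp : b ^ p ≠ 0 := pow_ne_zero _ hab.1
  obtain ⟨ε, hε⟩ := hO.exists_of_le_one (r := (a ^ p - e) / b ^ p) (by
    rw [Valuation.comap_apply, map_div₀, map_div₀, _root_.map_sub, he, map_pow, ← sub_pow_char,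
      map_pow, map_pow, map_pow, v.map_sub_swap, hab.2, div_self]
    exact pow_ne_zero _ (by simpa using hab.1))
  have hcomp : (X ^ p - C e : E[X]).comp (C a + C b * X) =
      C (b ^ p) * (X ^ p + C ε : O[X]).map (algebraMap O E) := by
    simp only [sub_comp, pow_comp, X_comp, C_comp, Polynomial.map_add, Polynomial.map_pow, map_X,
      map_C, hε, mul_add, ← C_mul]
    rw [mul_div_cancel₀ _ hbp, add_pow_char, mul_pow, C_sub, C_pow, C_pow]
    ring
  have hmapf : (X ^ p + C ε : O[X]).map (residue O) = X ^ p + C (residue O ε) := by simp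
  have hdegf : ((X ^ p + C ε : O[X]).map (residue O)).natDegree = p := by
    rw [hmapf, natDegree_X_pow_add_C]
  have hkey := hH.2.1.symm.trans hcomp
  have hdegH : (H.map (residue O)).natDegree = p := by
    have hbv : 0 < v (algebraMap E L (b ^ p)) := v.pos_iff.2 (by simpa using hbp)
    have hsv : 0 < v (algebraMap E L s) := v.pos_iff.2 (by simpa using hH.1)
    have hinj := map_injective (algebraMap O E) hO.hom_inj
    rcases le_total (v (algebraMap E L s)) (v (algebraMap E L (b ^ p))) with h | h
    · obtain ⟨ρ, hρ⟩ := hO.exists_of_le_one (r := s / b ^ p) (by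
        rw [Valuation.comap_apply, map_div₀, map_div₀]
        exact div_le_one_of_le₀ h zero_le)
      have h1 : C ρ * H = X ^ p + C ε := by
        apply hinj
        apply mul_left_cancel₀ (C_ne_zero.2 hbp)
        rw [← hkey, Polynomial.map_mul, map_C, hρ, ← mul_assoc, ← C_mul, mul_div_cancel₀ _ hbp]
      rw [← h1, Polynomial.map_mul, map_C] at hdegf
      rw [natDegree_C_mul] at hdegf
      · exact hdegf
      · intro h0
        rw [h0, C_0, zero_mul, natDegree_zero] at hdegf
        exact hp.ne_zero hdegf.symm
    · obtain ⟨ρ, hρ⟩ := hO.exists_of_le_one (r := b ^ p / s) (by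
        rw [Valuation.comap_apply, map_div₀, map_div₀]
        exact div_le_one_of_le₀ h zero_le)
      have h1 : C ρ * (X ^ p + C ε) = H := by
        apply hinj
        apply mul_left_cancel₀ (C_ne_zero.2 hH.1)
        rw [hkey, Polynomial.map_mul, map_C, hρ, ← mul_assoc, ← C_mul, mul_div_cancel₀ _ hH.1]
      rw [← h1, Polynomial.map_mul, map_C, natDegree_C_mul, hdegf]
      intro h0
      refine hH.2.2 ?_
      rw [← h1, Polynomial.map_mul, map_C, h0, C_0, zero_mul]
  rw [hHP, natDegree_comp] at hdegH
  have hGlt : (G.map (residue O)).natDegree < p :=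
    (natDegree_map_le.trans (hG.natDegree_le hO)).trans_lt hgp
  have hG1 : (G.map (residue O)).natDegree = 1 := by
    refine ((Nat.dvd_prime hp).1 (Dvd.intro_left _ hdegH)).resolve_right hGlt.ne
  rw [hG1, mul_one] at hdegH
  rw [hdegH, natDegree_X_pow_sub_C] at hPdeg
  have := Nat.mul_lt_mul_of_pos_left hdeg2 hp.pos
  omega

lemma Valuation.Integers.exists_subset_adjoin_of_immediate (hfin : Module.finrank E L = p)
    (hO : (v.comap (algebraMap E L)).Integers O)
    (hyE : y ∉ Set.range (algebraMap E L)) (hyp : y ^ p ∈ Set.range (algebraMap E L))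
    (himm : ∀ w : L, w ≠ 0 → ∃ c, v (w - algebraMap E L c) < v w)
    (S : Finset L) (hS : ∀ s ∈ S, v s ≤ 1) :
    ∃ x, v x ≤ 1 ∧ x ∉ Set.range (algebraMap E L) ∧ ∀ s ∈ S, s ∈ Algebra.adjoin O {x} := by
  have hne (a : E) : y - algebraMap E L a ≠ 0 := fun h ↦ hyE ⟨a, (sub_eq_zero.1 h).symm⟩
  have hnear (a : E) : ∃ a', v (y - algebraMap E L a') < v (y - algebraMap E L a) := by
    obtain ⟨c, hc⟩ := himm _ (hne a)
    refine ⟨a + c, ?_⟩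
    rwa [map_add, ← sub_sub]
  have hscale (a : E) : ∃ b, IsScale v y a b := by
    obtain ⟨c, hc⟩ := himm _ (hne a)
    have h1 := v.map_sub_eq_of_lt_left hc
    rw [sub_sub_cancel] at h1
    refine ⟨c, ?_, h1.symm⟩
    rintro rfl
    rw [map_zero, map_zero, eq_comm, v.zero_iff] at h1
    exact hne a h1
  have hz {a b : E} (hab : IsScale v y a b) :
      v ((y - algebraMap E L a) / algebraMap E L b) = 1 := by
    rw [map_div₀, hab.2, div_self]
    simpa using hab.1
  have hred (a b : E) (hab : IsScale v y a b) :
      ∃ τ : O, v ((y - algebraMap E L a) / algebraMap E L b - algebraMap O L τ) < 1 := by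
    obtain ⟨c, hc⟩ := himm ((y - algebraMap E L a) / algebraMap E L b)
      (v.ne_zero_iff.1 (by rw [hz hab]; exact one_ne_zero))
    have h1 := v.map_sub_eq_of_lt_left hc
    rw [sub_sub_cancel, hz hab] at h1
    obtain ⟨τ, hτ⟩ := hO.exists_of_le_one (r := c) h1.le
    refine ⟨τ, ?_⟩
    rwa [IsScalarTower.algebraMap_apply O E L, hτ, ← hz hab]
  choose g hg hgS using exists_aeval_eq_of_notMem_range hfin hyE hyp
  have hall : NearTo v y fun a ↦ ∀ w ∈ S, ∀ b, IsScale v y a b →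
      w ∈ Algebra.adjoin O {(y - algebraMap E L a) / algebraMap E L b} := by
    refine NearTo.forall_finset S fun w hw ↦ ?_
    rcases eq_or_ne (g w) 0 with h0 | h0
    · refine ⟨0, fun a _ b _ ↦ ?_⟩
      rw [← hgS w, h0, map_zero]
      exact zero_mem _
    refine ((isGood_of_natDegree_lt hO hyp hscale hnear hred h0 (hg w)).nearTo hO).mono
      fun a ha b hab ↦ ?_
    obtain ⟨s, H, c, hH, hHc, hc⟩ := ha b hab
    obtain ⟨τ, hτ⟩ := hred a b hab
    have h1 := (hO.valuation_aeval_eq_one_iff hτ H).2 (by rwa [hHc, eval_C])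
    have h2 := hab.aeval_eq hH.2.1
    rw [hgS] at h2
    have h3 := hS w hw
    rw [h2, map_mul, h1, mul_one] at h3
    rw [h2]
    exact hO.mul_aeval_mem_adjoin _ H h3
  obtain ⟨a₀, ha₀⟩ := hall
  obtain ⟨a, ha⟩ := hnear a₀
  obtain ⟨b, hab⟩ := hscale a
  refine ⟨(y - algebraMap E L a) / algebraMap E L b, (hz hab).le, ?_, fun s hs ↦ ha₀ a ha s hs b hab⟩
  rintro ⟨e, he⟩
  refine hyE ⟨a + b * e, ?_⟩
  have hb : algebraMap E L b ≠ 0 := by simpa using hab.1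
  rw [map_add, map_mul, he, mul_div_cancel₀ _ hb, add_sub_cancel]

/-- Every finite set of integral elements of a purely inseparable extension of degree `p` is
contained in a subring generated by one integral element over the integers of the base field. -/
lemma Valuation.Integers.exists_subset_adjoin_singleton (hfin : Module.finrank E L = p)
    (hO : (v.comap (algebraMap E L)).Integers O)
    (hpow : ∀ x : L, x ^ p ∈ Set.range (algebraMap E L))
    (S : Finset L) (hS : ∀ s ∈ S, v s ≤ 1) :
    ∃ x, v x ≤ 1 ∧ x ∉ Set.range (algebraMap E L) ∧ ∀ s ∈ S, s ∈ Algebra.adjoin O {x} := by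
  by_cases hval : ∃ z, z ≠ 0 ∧ ∀ e, v (algebraMap E L e) ≠ v z
  · obtain ⟨z, hz0, hz⟩ := hval
    exact hO.exists_subset_adjoin_of_valuation_notMem hfin hz0 (hpow z) hz S hS
  push Not at hval
  by_cases himm : ∀ w : L, w ≠ 0 → ∃ c, v (w - algebraMap E L c) < v w
  · obtain ⟨y, hy⟩ : ∃ y, y ∉ Set.range (algebraMap E L) := by
      by_contra! h
      have h1 : Module.finrank E L ≤ 1 := finrank_le_one (1 : L) fun w ↦ by
        obtain ⟨e, he⟩ := h w
        exact ⟨e, by rw [← he, Algebra.smul_def, mul_one]⟩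
      exact (Fact.out : p.Prime).one_lt.not_ge (hfin ▸ h1)
    exact hO.exists_subset_adjoin_of_immediate hfin hy (hpow y) himm S hS
  push Not at himm
  obtain ⟨w, hw0, hw⟩ := himm
  obtain ⟨e, he⟩ := hval w hw0
  have hwv : v w ≠ 0 := v.ne_zero_iff.2 hw0
  have he0 : algebraMap E L e ≠ 0 := v.ne_zero_iff.1 (by rwa [he])
  have hz : v (w / algebraMap E L e) = 1 := by rw [map_div₀, he, div_self hwv]
  have hz' (c : E) : 1 ≤ v (w / algebraMap E L e - algebraMap E L c) := by
    have h1 : w / algebraMap E L e - algebraMap E L c =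
        (w - algebraMap E L (e * c)) / algebraMap E L e := by
      rw [map_mul]; field_simp
    rw [h1, map_div₀, he, one_le_div₀ (zero_lt_iff.2 hwv)]
    exact hw _
  have hzE : w / algebraMap E L e ∉ Set.range (algebraMap E L) := by
    rintro ⟨c, hc⟩
    have := hz' c
    rw [hc, sub_self, map_zero] at this
    exact absurd this (not_le.2 zero_lt_one)
  have hτ (τ : O) : v (w / algebraMap E L e - algebraMap O L τ) = 1 := by
    rw [IsScalarTower.algebraMap_apply O E L]
    exact le_antisymm (v.map_sub_le hz.le (hO.map_le_one τ)) (hz' _)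
  exact ⟨_, hz.le, hzE, fun s hs ↦
    hO.mem_adjoin_of_residue_notMem hfin hz hzE (hpow _) hτ (hS s hs)⟩

end ImmediateStep

section Fields

variable {p : ℕ} [Fact p.Prime] {K Γ : Type*} [Field K] [CharP K p]
  [LinearOrderedCommGroupWithZero Γ] {v : Valuation K Γ}

lemma Valuation.Integers.exists_eq_sum_mul_pow {E L O : Type*} [Field E] [Field L] [CharP L p]
    [Algebra E L] {v : Valuation L Γ} [CommRing O] [Nontrivial O] [Algebra O E] [Algebra O L]
    [IsScalarTower O E L] (hO : (v.comap (algebraMap E L)).Integers O)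
    {x : L} (hx : v x ≤ 1) (hxp : x ^ p ∈ Set.range (algebraMap E L)) {s : L}
    (hs : s ∈ Algebra.adjoin O {x}) :
    ∃ a : Fin p → O, s = ∑ i, algebraMap O L (a i) * x ^ (i : ℕ) := by
  have hp : p.Prime := Fact.out
  rw [Algebra.adjoin_singleton_eq_range_aeval] at hs
  obtain ⟨g, rfl⟩ := hs
  obtain ⟨e, he⟩ := hxp
  obtain ⟨a, rfl⟩ := hO.exists_of_le_one (r := e) (by
    rw [Valuation.comap_apply, he, map_pow]; exact pow_le_one₀ zero_le hx)
  have hroot : aeval x (X ^ p - C a : O[X]) = 0 := by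
    rw [_root_.map_sub, map_pow, aeval_X, aeval_C, IsScalarTower.algebraMap_apply O E L, he,
      sub_self]
  have hdeg : (g %ₘ (X ^ p - C a)).natDegree < p := by
    have hne : (X ^ p - C a : O[X]) ≠ 1 := by
      intro h
      have := congr_arg natDegree h
      rw [natDegree_X_pow_sub_C, natDegree_one] at this
      exact hp.ne_zero this
    have := natDegree_modByMonic_lt g (monic_X_pow_sub_C a hp.ne_zero) hne
    rwa [natDegree_X_pow_sub_C] at this
  refine ⟨fun i ↦ (g %ₘ (X ^ p - C a)).coeff i, ?_⟩
  change aeval x g = _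
  rw [← aeval_modByMonic_eq_self_of_root hroot, aeval_eq_sum_range' hdeg, ← Fin.sum_univ_eq_sum_range
    (fun i ↦ (g %ₘ (X ^ p - C a)).coeff i • x ^ i)]
  simp only [Algebra.smul_def]

lemma exists_integral_generator {F : Subfield K} (hF : ∀ x : K, x ^ p ∈ F) {y : K} (hy : y ∉ F)
    (S : Finset K) (hS : ∀ s ∈ S, s ∈ IntermediateField.adjoin F {y} ∧ v s ≤ 1) :
    ∃ x ∈ IntermediateField.adjoin F {y}, v x ≤ 1 ∧ x ∉ F ∧
      ∀ s ∈ S, ∃ a : Fin p → K, (∀ i, a i ∈ F ∧ v (a i) ≤ 1) ∧ s = ∑ i, a i * x ^ (i : ℕ) := by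
  classical
  have hp : p.Prime := Fact.out
  have hyr : y ∉ Set.range (algebraMap F K) := by
    rintro ⟨e, rfl⟩
    exact hy e.2
  have hpow (x : IntermediateField.adjoin F {y}) :
      x ^ p ∈ Set.range (algebraMap F (IntermediateField.adjoin F {y})) :=
    ⟨⟨(x : K) ^ p, hF _⟩, Subtype.ext rfl⟩
  have hyp : algebraMap F K ⟨y ^ p, hF y⟩ = y ^ p := rfl
  have hfin : Module.finrank F (IntermediateField.adjoin F {y}) = p := by
    rw [IntermediateField.adjoin.finrank, minpoly_eq_X_pow_sub_C hyr hyp, natDegree_X_pow_sub_C]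
    exact ⟨X ^ p - C ⟨y ^ p, hF y⟩, monic_X_pow_sub_C _ hp.ne_zero, by
      rw [eval₂_sub, eval₂_X_pow, eval₂_C, hyp, sub_self]⟩
  have : CharP (IntermediateField.adjoin F {y}) p :=
    (RingHom.charP_iff (algebraMap (IntermediateField.adjoin F {y}) K)
      (algebraMap (IntermediateField.adjoin F {y}) K).injective p).2 ‹_›
  let v' : Valuation (IntermediateField.adjoin F {y}) Γ := v.comap (algebraMap _ K)
  let O := (v'.comap (algebraMap F (IntermediateField.adjoin F {y}))).valuationSubring
  have hO : (v'.comap (algebraMap F (IntermediateField.adjoin F {y}))).Integers O :=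
    Valuation.valuationSubring.integers _
  let _ : Algebra O (IntermediateField.adjoin F {y}) :=
    ((algebraMap F (IntermediateField.adjoin F {y})).comp (algebraMap O F)).toAlgebra
  have : IsScalarTower O F (IntermediateField.adjoin F {y}) := .of_algebraMap_eq fun _ ↦ rfl
  obtain ⟨x, hx, hxF, hxS⟩ := hO.exists_subset_adjoin_singleton hfin hpow
    (S.subtype (· ∈ IntermediateField.adjoin F {y}))
    (fun s hs ↦ (hS s (Finset.mem_subtype.1 hs)).2)
  refine ⟨x, x.2, hx, fun h ↦ hxF ⟨⟨x, h⟩, rfl⟩, fun s hs ↦ ?_⟩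
  obtain ⟨a, ha⟩ := hO.exists_eq_sum_mul_pow hx (hpow x)
    (hxS ⟨s, (hS s hs).1⟩ (Finset.mem_subtype.2 hs))
  refine ⟨fun i ↦ ((a i : F) : K), fun i ↦ ⟨(a i : F).2, (a i).2⟩, ?_⟩
  have := congr_arg (algebraMap (IntermediateField.adjoin F {y}) K) ha
  rw [map_sum] at this
  simp only [map_mul, map_pow] at this
  exact this

omit [Fact p.Prime] in
lemma pthPowerCombination_cons {R : Type*} [CommRing R] {n : ℕ} (x₀ : R) (x : Fin n → R)
    (c : (Fin (n + 1) → Fin p) → R) :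
    pthPowerCombination p (Fin.cons x₀ x : Fin (n + 1) → R) c =
      ∑ j : Fin p, pthPowerCombination p x (fun α ↦ c (Fin.cons j α)) * x₀ ^ (j : ℕ) := by
  rw [pthPowerCombination, ← (Fin.consEquiv fun _ : Fin (n + 1) ↦ Fin p).sum_comp,
    Fintype.sum_prod_type]
  refine Finset.sum_congr rfl fun j _ ↦ ?_
  rw [pthPowerCombination, Finset.sum_mul]
  refine Finset.sum_congr rfl fun α _ ↦ ?_
  change c (Fin.cons j α) ^ p * ∏ i, (Fin.cons x₀ x : Fin (n + 1) → R) i ^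
    ((Fin.cons j α : Fin (n + 1) → Fin p) i : ℕ) = _
  rw [Fin.prod_univ_succ]
  simp only [Fin.cons_zero, Fin.cons_succ]
  ring

/-- Finitely many integral elements of `F` lie in a subring generated by an integral `p`-independent
family and `p`-th powers. -/
def HasIntegralPthBases (p : ℕ) (v : Valuation K Γ) (F : Subfield K) : Prop :=
  ∀ S : Finset K, (∀ s ∈ S, s ∈ F ∧ v s ≤ 1) → ∃ (n : ℕ) (x : Fin n → K),
    (∀ i, x i ∈ F ∧ v (x i) ≤ 1) ∧ (∀ c, pthPowerCombination p x c = 0 → c = 0) ∧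
    ∀ s ∈ S, ∃ c, (∀ α, v (c α) ≤ 1) ∧ pthPowerCombination p x c = s

lemma HasIntegralPthBases.frobenius_fieldRange :
    HasIntegralPthBases p v (frobenius K p).fieldRange := by
  have hp : p.Prime := Fact.out
  refine fun S hS ↦ ⟨0, Fin.elim0, fun i ↦ i.elim0, fun c hc ↦ ?_, fun s hs ↦ ?_⟩
  · funext α
    rw [pthPowerCombination, Fintype.sum_unique] at hc
    rw [Finset.univ_eq_empty, Finset.prod_empty, mul_one] at hc
    exact (congr_arg c (Subsingleton.elim _ _)).trans (pow_eq_zero_iff hp.ne_zero |>.1 hc)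
  · obtain ⟨⟨b, rfl⟩, hb⟩ := hS s hs
    refine ⟨fun _ ↦ b, fun _ ↦ ?_, by simp [pthPowerCombination, frobenius_def]⟩
    rw [frobenius_def, map_pow] at hb
    exact (pow_le_one_iff hp.ne_zero).1 hb

lemma HasIntegralPthBases.adjoin {F : Subfield K} (h : HasIntegralPthBases p v F)
    (hF : ∀ x : K, x ^ p ∈ F) {y : K} (hy : y ∉ F) :
    HasIntegralPthBases p v (IntermediateField.adjoin F {y}).toSubfield := by
  classical
  have hp : p.Prime := Fact.out
  intro S hS
  obtain ⟨x₀, hx₀, hx₀v, hx₀F, hgen⟩ := exists_integral_generator hF hy S hS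
  choose! a haF ha using hgen
  obtain ⟨n, x, hx, hind, hspan⟩ := h (S.biUnion fun s ↦ Finset.univ.image (a s)) (by
    intro t ht
    obtain ⟨s, hs, ht⟩ := Finset.mem_biUnion.1 ht
    obtain ⟨i, -, rfl⟩ := Finset.mem_image.1 ht
    exact haF s hs i)
  refine ⟨n + 1, Fin.cons x₀ x, ?_, ?_, ?_⟩
  · refine Fin.cases ⟨hx₀, hx₀v⟩ fun i ↦ ⟨?_, (hx i).2⟩
    exact (IntermediateField.adjoin F {y}).algebraMap_mem ⟨x i, (hx i).1⟩
  · intro c hc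
    rw [pthPowerCombination_cons] at hc
    have hmem (j : Fin p) : pthPowerCombination p x (fun α ↦ c (Fin.cons j α)) ∈ F :=
      sum_mem fun α _ ↦ mul_mem (hF _) (prod_mem fun i _ ↦ pow_mem (hx i).1 _)
    let g : F[X] := ∑ j : Fin p, C ⟨_, hmem j⟩ * X ^ (j : ℕ)
    have hg : g = 0 := by
      by_contra hg
      refine aeval_ne_zero_of_natDegree_lt (x := x₀) ?_ ⟨⟨x₀ ^ p, hF _⟩, rfl⟩ hg ?_ ?_
      · rintro ⟨e, rfl⟩
        exact hx₀F e.2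
      · have : g.natDegree ≤ p - 1 := natDegree_sum_le_of_forall_le _ _ fun j _ ↦
          (natDegree_C_mul_X_pow_le _ _).trans (Nat.le_sub_one_of_lt j.2)
        have := hp.pos
        omega
      · rw [map_sum, ← hc]
        refine Finset.sum_congr rfl fun j _ ↦ ?_
        rw [map_mul, aeval_C, map_pow, aeval_X]
        rfl
    funext α
    have hcoeff : g.coeff (α 0) = ⟨_, hmem (α 0)⟩ := by
      simp only [g, finsetSum_coeff, coeff_C_mul, coeff_X_pow, Fin.val_inj]
      simp
    rw [hg, coeff_zero] at hcoeff
    have h0 := hind _ (congr_arg Subtype.val hcoeff).symm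
    have := congr_fun h0 (Fin.tail α)
    rwa [Fin.cons_self_tail] at this
  · intro s hs
    choose c hcv hc using fun i ↦ hspan (a s i)
      (Finset.mem_biUnion.2 ⟨s, hs, Finset.mem_image_of_mem _ (Finset.mem_univ i)⟩)
    refine ⟨fun α ↦ c (α 0) (Fin.tail α), fun α ↦ hcv _ _, ?_⟩
    rw [pthPowerCombination_cons, ha s hs]
    refine Finset.sum_congr rfl fun j _ ↦ ?_
    simp only [Fin.cons_zero, Fin.tail_cons, hc]

lemma exists_hasIntegralPthBases (v : Valuation K Γ) (T : Finset K) :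
    ∃ F : Subfield K, (∀ x : K, x ^ p ∈ F) ∧ (∀ t ∈ T, t ∈ F) ∧ HasIntegralPthBases p v F := by
  classical
  induction T using Finset.induction_on with
  | empty =>
    exact ⟨(frobenius K p).fieldRange, fun x ↦ RingHom.mem_fieldRange.2 ⟨x, rfl⟩, by simp, .frobenius_fieldRange⟩
  | insert t T _ ih =>
    obtain ⟨F, hF, hT, h⟩ := ih
    by_cases ht : t ∈ F
    · exact ⟨F, hF, Finset.forall_mem_insert .. |>.2 ⟨ht, hT⟩, h⟩
    · have hle (x : K) (hx : x ∈ F) : x ∈ (IntermediateField.adjoin F {t}).toSubfield :=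
        (IntermediateField.adjoin F {t}).algebraMap_mem ⟨x, hx⟩
      exact ⟨_, fun x ↦ hle _ (hF x), Finset.forall_mem_insert .. |>.2
        ⟨IntermediateField.mem_adjoin_simple_self F t, fun s hs ↦ hle s (hT s hs)⟩, h.adjoin hF ht⟩

end Fields

/-- Finitely many elements of a valuation ring of characteristic `p` lie in a subring generated by
a `p`-independent family and `p`-th powers. -/
lemma ValuationRing.exists_pthPowerCombination (p : ℕ) [Fact p.Prime] {V : Type*} [CommRing V]
    [IsDomain V] [ValuationRing V] [CharP V p] (S : Finset V) :
    ∃ (n : ℕ) (x : Fin n → V), (∀ c, pthPowerCombination p x c = 0 → c = 0) ∧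
      ∀ s ∈ S, ∃ c, pthPowerCombination p x c = s := by
  classical
  let f := algebraMap V (FractionRing V)
  have hf : Function.Injective f := IsFractionRing.injective V (FractionRing V)
  have : CharP (FractionRing V) p := (RingHom.charP_iff f hf p).1 ‹_›
  have hv (a : FractionRing V) :
      ValuationRing.valuation V (FractionRing V) a ≤ 1 ↔ ∃ b, f b = a :=
    ValuationRing.mem_integer_iff V (FractionRing V) a
  obtain ⟨F, -, hSF, h⟩ := exists_hasIntegralPthBases (p := p)
    (ValuationRing.valuation V (FractionRing V)) (S.image f)
  obtain ⟨n, x, hx, hind, hspan⟩ := h (S.image f) fun s hs ↦ ⟨hSF s hs, by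
    obtain ⟨b, -, rfl⟩ := Finset.mem_image.1 hs
    exact (hv _).2 ⟨b, rfl⟩⟩
  choose x' hx' using fun i ↦ (hv _).1 (hx i).2
  have hmap (c : (Fin n → Fin p) → V) :
      f (pthPowerCombination p x' c) = pthPowerCombination p x (fun α ↦ f (c α)) := by
    simp [pthPowerCombination, hx']
  refine ⟨n, x', fun c hc ↦ ?_, fun s hs ↦ ?_⟩
  · have h0 := hind _ ((hmap c).symm.trans (by rw [hc, map_zero]))
    funext α
    exact hf ((congr_fun h0 α).trans (map_zero f).symm)
  · obtain ⟨c, hc, hcs⟩ := hspan (f s) (Finset.mem_image_of_mem f hs)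
    choose c' hc' using fun α ↦ (hv _).1 (hc α)
    refine ⟨c', hf ?_⟩
    rw [hmap, ← hcs]
    simp only [hc']

/-- Let `p` be a prime and `V` a valuation ring of characteristic `p`. Then the
cotangent complex of `V` over `𝔽_p` is a flat `V`-module in degree zero: `Ω¹_{V/𝔽_p}` is a flat
`V`-module and `H¹Cotangent(𝔽_p, V)` vanishes. -/
theorem cotangentComplex_flat_of_valuationRing (p : ℕ) (hp : p.Prime)
    (V : Type*) [CommRing V] [IsDomain V] [ValuationRing V] [CharP V p] [Algebra (ZMod p) V] :
    Module.Flat V (KaehlerDifferential (ZMod p) V) ∧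
    Subsingleton (Algebra.H1Cotangent (ZMod p) V) := by
  have : Fact p.Prime := ⟨hp⟩
  have key := exists_hom_cotangent_map_eq_zero fun S ↦
    ValuationRing.exists_pthPowerCombination p (V := V) S
  refine ⟨?_, subsingleton_h1Cotangent_of_exists_hom _ key⟩
  rw [Module.Flat.flat_iff_torsion_eq_bot_of_isBezout, eq_bot_iff]
  rintro ω ⟨⟨c, hc⟩, hω⟩
  have : Module.Free V (Generators.self (ZMod p) V).toExtension.CotangentSpace :=
    Module.Free.of_basis (Generators.self (ZMod p) V).cotangentSpaceBasis
  exact kaehlerDifferential_smul_eq_zero_of_exists_hom _ key (nonZeroDivisors.ne_zero hc) hω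
end
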